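/- arXiv:1808.03367 — 7 statements merged into one kernel-verified Lean document; each statement's English description precedes it below -/
import Mathlib

section
/- Let γ ≥ 1 be a real number and let x₁, …, xₙ be points in the Euclidean plane ℝ². Then the area (two-dimensional Lebesgue measure) of the union of the closed unit disks centered at x₁, …, xₙ is at most the area of the union of the closed unit disks centered at γ·x₁, …, γ·xₙ. -/
open MeasureTheory Metric Real

/-- The Voronoi cell of `x i`, ties being broken in favour of the smallest index. -/
def voronoiCell {ι E : Type*} [LT ι] [Dist E] (x : ι → E) (i : ι) : Set E :=
  {y | (∀ j, dist y (x i) ≤ dist y (x j)) ∧ ∀ j < i, dist y (x i) < dist y (x j)}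

section VoronoiCell

variable {ι E : Type*}

theorem measurableSet_voronoiCell [LT ι] [Countable ι] [PseudoMetricSpace E] [MeasurableSpace E]
    [OpensMeasurableSpace E] (x : ι → E) (i : ι) : MeasurableSet (voronoiCell x i) := by
  have h : voronoiCell x i = (⋂ j, {y | dist y (x i) ≤ dist y (x j)}) ∩
      ⋂ j, ⋂ (_ : j < i), {y | dist y (x i) < dist y (x j)} := by
    ext y
    simp [voronoiCell]
  rw [h]
  refine (MeasurableSet.iInter fun j ↦ ?_).inter
    (MeasurableSet.iInter fun j ↦ MeasurableSet.iInter fun _ ↦ ?_)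
  · exact (isClosed_le (by fun_prop) (by fun_prop)).measurableSet
  · exact (isOpen_lt (by fun_prop) (by fun_prop)).measurableSet

theorem eq_of_mem_voronoiCell [LinearOrder ι] [Dist E] {x : ι → E} {y : E} {i j : ι}
    (hi : y ∈ voronoiCell x i) (hj : y ∈ voronoiCell x j) : i = j := by
  rcases lt_trichotomy i j with h | h | h
  · exact absurd (hj.2 i h) (hi.1 j).not_gt
  · exact h
  · exact absurd (hi.2 j h) (hj.1 i).not_gt

theorem pairwise_disjoint_voronoiCell [LinearOrder ι] [Dist E] (x : ι → E) :
    Pairwise (Function.onFun Disjoint (voronoiCell x)) := fun _ _ hij ↦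
  Set.disjoint_left.2 fun _ hi hj ↦ hij (eq_of_mem_voronoiCell hi hj)

theorem exists_mem_voronoiCell [LinearOrder ι] [Finite ι] [Nonempty ι] [Dist E] (x : ι → E)
    (y : E) : ∃ i, y ∈ voronoiCell x i := by
  obtain ⟨i, hi⟩ := Finite.exists_min fun i ↦ toLex (dist y (x i), i)
  refine ⟨i, fun j ↦ ?_, fun j hj ↦ ?_⟩
  · rcases Prod.Lex.toLex_le_toLex.1 (hi j) with h | h
    exacts [h.le, h.1.le]
  · rcases Prod.Lex.toLex_le_toLex.1 (hi j) with h | h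
    exacts [h, absurd h.2 hj.not_ge]

theorem mul_dist_sub_le_dist_add_smul [SeminormedAddCommGroup E] [NormedSpace ℝ E] {γ : ℝ}
    (hγ : 1 ≤ γ) (z a b : E) :
    γ * dist (z + (a - γ • a)) b - (γ - 1) * dist z (γ • a) ≤ dist z (γ • b) := by
  have h : γ • (z + (a - γ • a) - b) = (z - γ • b) + (γ - 1) • (z - γ • a) := by module
  have := norm_add_le (z - γ • b) ((γ - 1) • (z - γ • a))
  rw [← h, norm_smul, norm_smul, Real.norm_of_nonneg (by linarith),
    Real.norm_of_nonneg (by linarith)] at this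
  simp only [dist_eq_norm]
  linarith

/-- Translating a Voronoi cell of `x` along with its center, from `x i` to `γ • x i`, moves it
into the corresponding Voronoi cell of `γ • x`. -/
theorem mem_voronoiCell_smul [LT ι] [SeminormedAddCommGroup E] [NormedSpace ℝ E] {γ : ℝ}
    (hγ : 1 ≤ γ) {x : ι → E} {i : ι} {z : E} (hz : z + (x i - γ • x i) ∈ voronoiCell x i) :
    z ∈ voronoiCell (fun j ↦ γ • x j) i := by
  have hd : dist (z + (x i - γ • x i)) (x i) = dist z (γ • x i) := by
    simp only [dist_eq_norm]
    congr 1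
    abel
  obtain ⟨hle, hlt⟩ := hz
  rw [hd] at hle hlt
  refine ⟨fun j ↦ ?_, fun j hj ↦ ?_⟩
  · have := mul_dist_sub_le_dist_add_smul hγ z (x i) (x j)
    nlinarith [hle j]
  · have := mul_dist_sub_le_dist_add_smul hγ z (x i) (x j)
    nlinarith [hlt j hj]

end VoronoiCell

/-- Dilating the centers of finitely many balls of equal radius by a factor `γ ≥ 1` does not
decrease the measure of their union, for any translation-invariant measure. -/
theorem measure_iUnion_closedBall_le_of_dilate {ι E : Type*} [LinearOrder ι] [Finite ι]
    [SeminormedAddCommGroup E] [NormedSpace ℝ E] [MeasurableSpace E] [BorelSpace E]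
    (μ : Measure E) [μ.IsAddRightInvariant] {γ : ℝ} (hγ : 1 ≤ γ) (x : ι → E) (r : ℝ) :
    μ (⋃ i, closedBall (x i) r) ≤ μ (⋃ i, closedBall (γ • x i) r) := by
  let P : ι → Set E := fun i ↦ voronoiCell x i ∩ closedBall (x i) r
  let Q : ι → Set E := fun i ↦ (· + (x i - γ • x i)) ⁻¹' P i
  have hcover : ⋃ i, closedBall (x i) r ⊆ ⋃ i, P i := by
    refine Set.iUnion_subset fun i y hy ↦ ?_
    have : Nonempty ι := ⟨i⟩
    obtain ⟨j, hj⟩ := exists_mem_voronoiCell x y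
    exact Set.mem_iUnion.2 ⟨j, hj, (hj.1 i).trans hy⟩
  have hQ_disj : Pairwise (Function.onFun Disjoint Q) := fun i j hij ↦
    (pairwise_disjoint_voronoiCell (fun k ↦ γ • x k) hij).mono
      (fun _ hz ↦ mem_voronoiCell_smul hγ hz.1) fun _ hz ↦ mem_voronoiCell_smul hγ hz.1
  have hQ_meas (i : ι) : MeasurableSet (Q i) :=
    ((measurableSet_voronoiCell x i).inter measurableSet_closedBall).preimage
      (continuous_add_const _).measurable
  have hQ_sub (i : ι) : Q i ⊆ closedBall (γ • x i) r := fun z hz ↦ by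
    have h : dist (z + (x i - γ • x i)) (x i) ≤ r := hz.2
    rw [dist_eq_norm] at h
    rw [mem_closedBall, dist_eq_norm]
    convert h using 2
    abel
  calc μ (⋃ i, closedBall (x i) r) ≤ μ (⋃ i, P i) := measure_mono hcover
    _ ≤ ∑' i, μ (P i) := measure_iUnion_le P
    _ = ∑' i, μ (Q i) := by simp only [Q, measure_preimage_add_right]
    _ = μ (⋃ i, Q i) := (measure_iUnion hQ_disj hQ_meas).symm
    _ ≤ μ (⋃ i, closedBall (γ • x i) r) := measure_mono (Set.iUnion_mono hQ_sub)

/-- Bollobás's fact: dilating the centers of a finite family of unit disks in the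
plane by a factor `γ ≥ 1` does not decrease the area of their union. -/
theorem area_union_unitDisks_le_of_dilate
    (n : ℕ) (γ : ℝ) (hγ : 1 ≤ γ) (x : Fin n → EuclideanSpace ℝ (Fin 2)) :
    volume (⋃ i, closedBall (x i) 1) ≤ volume (⋃ i, closedBall (γ • x i) 1) :=
  measure_iUnion_closedBall_le_of_dilate volume hγ x 1
end

section
/- Let x₁, …, xₙ : [0,1] → ℝ² be continuous paths in the Euclidean plane such that for every pair of indices i, j, the distance ‖xᵢ(t) − xⱼ(t)‖ is a nondecreasing function of t ∈ [0,1]. Then the area of the union of the closed unit disks centered at x₁(t), …, xₙ(t) is a nondecreasing function of t; in particular the area of the union at t = 0 is at most the area of the union at t = 1. -/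
open MeasureTheory Metric Real Set

section GaussBump

variable {V : Type*} [NormedAddCommGroup V]

/-- The Gaussian `exp (l (1 - ‖w - a‖²))`, which for large `l` separates the closed unit ball
around `a` from its complement. -/
noncomputable def gaussBump (l : ℝ) (a w : V) : ℝ := exp (l * (1 - ‖w - a‖ ^ 2))

/-- The sum of the Gaussian bumps around the points `a i`. -/
noncomputable def bumpSum {ι : Type*} [Fintype ι] (l : ℝ) (a : ι → V) (w : V) : ℝ :=
  ∑ i, gaussBump l (a i) w

lemma gaussBump_nonneg (l : ℝ) (a w : V) : 0 ≤ gaussBump l a w := (exp_pos _).le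

@[fun_prop]
lemma continuous_gaussBump (l : ℝ) (a : V) : Continuous (gaussBump l a) := by
  unfold gaussBump; fun_prop

section Sum

variable {ι : Type*} [Fintype ι]

lemma bumpSum_nonneg (l : ℝ) (a : ι → V) (w : V) : 0 ≤ bumpSum l a w :=
  Finset.sum_nonneg fun _ _ => gaussBump_nonneg _ _ _

@[fun_prop]
lemma continuous_bumpSum (l : ℝ) (a : ι → V) : Continuous (bumpSum l a) := by
  unfold bumpSum; fun_prop

lemma gaussBump_le_bumpSum (l : ℝ) (a : ι → V) (w : V) (i : ι) :
    gaussBump l (a i) w ≤ bumpSum l a w :=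
  Finset.single_le_sum (f := fun i => gaussBump l (a i) w)
    (fun _ _ => gaussBump_nonneg _ _ _) (Finset.mem_univ i)

lemma exp_neg_bumpSum_le_one (l : ℝ) (a : ι → V) (w : V) : exp (-bumpSum l a w) ≤ 1 :=
  exp_le_one_iff.2 (neg_nonpos.2 (bumpSum_nonneg _ _ _))

lemma bumpSum_mul_exp_neg_le_one (l : ℝ) (a : ι → V) (w : V) :
    bumpSum l a w * exp (-bumpSum l a w) ≤ 1 := by
  rw [exp_neg, ← div_eq_mul_inv, div_le_one (exp_pos _)]
  linarith [add_one_le_exp (bumpSum l a w)]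

lemma abs_one_sub_bumpSum_mul_exp_neg_le_one (l : ℝ) (a : ι → V) (w : V) :
    |(1 - bumpSum l a w) * exp (-bumpSum l a w)| ≤ 1 := by
  rw [abs_le]
  have h₁ := bumpSum_mul_exp_neg_le_one l a w
  have h₂ := exp_neg_bumpSum_le_one l a w
  have h₃ := mul_nonneg (bumpSum_nonneg l a w) (exp_pos (-bumpSum l a w)).le
  constructor <;> nlinarith [exp_pos (-bumpSum l a w)]

lemma gaussBump_mul_exp_neg_bumpSum_le_one (l : ℝ) (a : ι → V) (w : V) (i : ι) :
    gaussBump l (a i) w * exp (-bumpSum l a w) ≤ 1 :=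
  (mul_le_mul_of_nonneg_right (gaussBump_le_bumpSum l a w i) (exp_pos _).le).trans
    (bumpSum_mul_exp_neg_le_one l a w)

end Sum

/-- A bound on a Gaussian times an affine weight that is uniform over centers in a ball. -/
lemma gaussBump_mul_one_add_norm_le {l R : ℝ} (hl : 0 < l) {a : V} (ha : ‖a‖ ≤ R) (w : V) :
    gaussBump l a w * (1 + ‖w - a‖) ≤
      2 * (1 + 2 / l) * exp (l + l * R ^ 2 / 2) * exp (-(l / 4) * ‖w‖ ^ 2) := by
  set u := ‖w - a‖
  have hu0 : 0 ≤ u := norm_nonneg _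
  have hw : ‖w‖ ≤ u + R := by
    calc ‖w‖ = ‖(w - a) + a‖ := by simp
      _ ≤ u + ‖a‖ := norm_add_le _ _
      _ ≤ u + R := by gcongr
  have hw2 : ‖w‖ ^ 2 ≤ 2 * u ^ 2 + 2 * R ^ 2 := by
    nlinarith [sq_nonneg (u - R), norm_nonneg w]
  have h₁ : 1 + u ≤ 2 * (1 + 2 / l) * exp (l / 2 * u ^ 2) := by
    have h := add_one_le_exp (l / 2 * u ^ 2)
    have hl2 : (0 : ℝ) < 2 / l := by positivity
    have : (2 / l) * (l / 2 * u ^ 2) = u ^ 2 := by field_simp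
    have h3 : (0 : ℝ) ≤ l / 2 * u ^ 2 := by positivity
    calc 1 + u ≤ 2 * (1 + u ^ 2) := by nlinarith [sq_nonneg (u - 1)]
      _ ≤ 2 * (1 + 2 / l) * (l / 2 * u ^ 2 + 1) := by nlinarith
      _ ≤ _ := by gcongr
  calc gaussBump l a w * (1 + u)
      ≤ exp (l * (1 - u ^ 2)) * (2 * (1 + 2 / l) * exp (l / 2 * u ^ 2)) := by
        unfold gaussBump; gcongr
    _ = 2 * (1 + 2 / l) * exp (l * (1 - u ^ 2) + l / 2 * u ^ 2) := by rw [exp_add]; ring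
    _ ≤ 2 * (1 + 2 / l) * exp (l + l * R ^ 2 / 2 + -(l / 4) * ‖w‖ ^ 2) := by
        have : l * (1 - u ^ 2) + l / 2 * u ^ 2 ≤ l + l * R ^ 2 / 2 + -(l / 4) * ‖w‖ ^ 2 := by
          nlinarith
        have hl2 : (0 : ℝ) < 2 / l := by positivity
        exact mul_le_mul_of_nonneg_left (exp_le_exp.2 this) (by positivity)
    _ = _ := by rw [exp_add]; ring

end GaussBump

section Derivative

variable {V : Type*} [NormedAddCommGroup V] [InnerProductSpace ℝ V]
  {ι : Type*} [Fintype ι]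

lemma hasDerivAt_exp_mul_one_sub_norm_sq (l : ℝ) {u : ℝ → V} {u' : V} {t : ℝ}
    (hu : HasDerivAt u u' t) :
    HasDerivAt (fun s => exp (l * (1 - ‖u s‖ ^ 2)))
      (-2 * l * (exp (l * (1 - ‖u t‖ ^ 2)) * inner ℝ (u t) u')) t := by
  convert! ((hu.norm_sq.const_sub 1).const_mul l).exp using 1
  ring

lemma hasDerivAt_gaussBump_center (l : ℝ) {x : ℝ → V} {x' : V} {t : ℝ}
    (hx : HasDerivAt x x' t) (w : V) :
    HasDerivAt (fun s => gaussBump l (x s) w)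
      (2 * l * (gaussBump l (x t) w * inner ℝ (w - x t) x')) t := by
  convert! hasDerivAt_exp_mul_one_sub_norm_sq l (hx.const_sub w) using 1
  simp [gaussBump, inner_neg_right]

lemma hasLineDerivAt_gaussBump (l : ℝ) (a w v : V) :
    HasLineDerivAt ℝ (gaussBump l a)
      (-2 * l * (gaussBump l a w * inner ℝ (w - a) v)) w v := by
  have h : HasDerivAt (fun s : ℝ => w + s • v - a) v 0 := by
    simpa using (((hasDerivAt_id (0 : ℝ)).smul_const v).const_add w).sub_const a
  have h' := hasDerivAt_exp_mul_one_sub_norm_sq l h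
  simp only [zero_smul, add_zero] at h'
  exact h'

lemma hasDerivAt_bumpSum_mul_exp_neg (l : ℝ) {x : ι → ℝ → V} {x' : ι → V} {t : ℝ}
    (hx : ∀ i, HasDerivAt (x i) (x' i) t) (w : V) :
    HasDerivAt (fun s => bumpSum l (fun i => x i s) w * exp (-bumpSum l (fun i => x i s) w))
      ((1 - bumpSum l (fun i => x i t) w) * exp (-bumpSum l (fun i => x i t) w) *
        ∑ i, 2 * l * (gaussBump l (x i t) w * inner ℝ (w - x i t) (x' i))) t := by
  have h : HasDerivAt (fun s => bumpSum l (fun i => x i s) w)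
      (∑ i, 2 * l * (gaussBump l (x i t) w * inner ℝ (w - x i t) (x' i))) t := by
    unfold bumpSum
    exact HasDerivAt.fun_sum fun i _ => hasDerivAt_gaussBump_center l (hx i) w
  convert! h.mul h.neg.exp using 1
  simp only [Pi.neg_apply]
  ring

lemma hasLineDerivAt_gaussBump_mul_exp_neg_bumpSum (l : ℝ) (a : ι → V) (i : ι) (w v : V) :
    HasLineDerivAt ℝ (fun w => gaussBump l (a i) w * exp (-bumpSum l a w))
      (-2 * l * (exp (-bumpSum l a w) * (gaussBump l (a i) w * inner ℝ (w - a i) v -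
        gaussBump l (a i) w * ∑ k, gaussBump l (a k) w * inner ℝ (w - a k) v))) w v := by
  have h : HasLineDerivAt ℝ (bumpSum l a)
      (∑ k, -2 * l * (gaussBump l (a k) w * inner ℝ (w - a k) v)) w v := by
    unfold bumpSum HasLineDerivAt
    exact HasDerivAt.fun_sum fun k _ => hasLineDerivAt_gaussBump l (a k) w v
  have h₁ := HasDerivAt.mul (hasLineDerivAt_gaussBump l (a i) w v)
    (HasDerivAt.exp (HasDerivAt.neg h))
  unfold HasLineDerivAt
  convert! h₁ using 1
  simp only [zero_smul, add_zero, Pi.neg_apply, ← Finset.mul_sum]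
  ring

lemma sum_bump_inner_identity (g : ι → ℝ) (a v : ι → V) (w : V) :
    (1 - ∑ i, g i) * (∑ i, g i * inner ℝ (w - a i) (v i)) =
      (∑ i, (g i * inner ℝ (w - a i) (v i) - g i * ∑ k, g k * inner ℝ (w - a k) (v i))) +
      (∑ i, ∑ k, g i * g k * inner ℝ (a i - a k) (v i - v k)) / 2 := by
  have h₁ : ∑ i, ∑ k, g i * g k * inner ℝ (a i - a k) (v i - v k) =
      2 * ∑ i, ∑ k, g i * g k * inner ℝ (a i - a k) (v i) := by
    have : ∑ i, ∑ k, g i * g k * inner ℝ (a i - a k) (-v k) =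
        ∑ i, ∑ k, g i * g k * inner ℝ (a i - a k) (v i) := by
      rw [Finset.sum_comm]
      refine Finset.sum_congr rfl fun i _ => Finset.sum_congr rfl fun k _ => ?_
      rw [← neg_sub, inner_neg_neg]
      ring
    rw [two_mul]
    nth_rw 2 [← this]
    simp only [← Finset.sum_add_distrib, ← mul_add, ← inner_add_right, ← sub_eq_add_neg]
  rw [h₁, mul_div_cancel_left₀ _ two_ne_zero, Finset.sum_sub_distrib, sub_mul, one_mul,
    sub_eq_add_neg, sub_eq_add_neg, add_assoc]
  congr 1
  rw [Finset.sum_mul_sum, Finset.sum_comm, ← Finset.sum_neg_distrib, ← Finset.sum_neg_distrib,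
    ← Finset.sum_add_distrib]
  refine Finset.sum_congr rfl fun i _ => ?_
  rw [Finset.mul_sum, ← Finset.sum_neg_distrib, ← Finset.sum_neg_distrib,
    ← Finset.sum_add_distrib]
  refine Finset.sum_congr rfl fun k _ => ?_
  rw [← sub_sub_sub_cancel_left (a k) (a i) w, inner_sub_left (w - a k)]
  ring

variable [FiniteDimensional ℝ V] [MeasurableSpace V] [BorelSpace V]

lemma integrable_exp_neg_mul_sq_norm {b : ℝ} (hb : 0 < b) :
    Integrable (fun w : V => exp (-b * ‖w‖ ^ 2)) := by
  have h := (GaussianFourier.integrable_cexp_neg_mul_sq_norm_add (V := V) (b := (b : ℂ))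
    (by simpa using hb) 0 0).norm
  refine h.congr (.of_forall fun w => ?_)
  simp only [inner_zero_left, Complex.norm_exp]
  congr 1
  norm_cast
  simp

lemma integrable_gaussBump_mul_one_add_norm {l : ℝ} (hl : 0 < l) (a : V) :
    Integrable (fun w => gaussBump l a w * (1 + ‖w - a‖)) := by
  refine ((integrable_exp_neg_mul_sq_norm (V := V) (by positivity : 0 < l / 4)).const_mul
    (2 * (1 + 2 / l) * exp (l + l * ‖a‖ ^ 2 / 2))).mono'
    (Continuous.aestronglyMeasurable (by fun_prop)) (.of_forall fun w => ?_)
  rw [Real.norm_of_nonneg (mul_nonneg (gaussBump_nonneg _ _ _) (by positivity))]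
  exact gaussBump_mul_one_add_norm_le hl le_rfl w

lemma integrable_gaussBump {l : ℝ} (hl : 0 < l) (a : V) : Integrable (gaussBump l a) := by
  refine (integrable_gaussBump_mul_one_add_norm hl a).mono'
    (continuous_gaussBump l a).aestronglyMeasurable (.of_forall fun w => ?_)
  rw [Real.norm_of_nonneg (gaussBump_nonneg _ _ _)]
  exact le_mul_of_one_le_right (gaussBump_nonneg _ _ _) (by linarith [norm_nonneg (w - a)])

lemma integrable_gaussBump_mul_inner {l : ℝ} (hl : 0 < l) (a v : V) :
    Integrable (fun w => gaussBump l a w * inner ℝ (w - a) v) := by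
  refine ((integrable_gaussBump_mul_one_add_norm hl a).mul_const ‖v‖).mono'
    (Continuous.aestronglyMeasurable (by fun_prop)) (.of_forall fun w => ?_)
  rw [norm_mul, Real.norm_of_nonneg (gaussBump_nonneg _ _ _), mul_assoc]
  refine mul_le_mul_of_nonneg_left ?_ (gaussBump_nonneg _ _ _)
  exact (norm_inner_le_norm _ _).trans (by gcongr; linarith)

lemma integrable_bumpSum {l : ℝ} (hl : 0 < l) (a : ι → V) : Integrable (bumpSum l a) :=
  integrable_finsetSum _ fun i _ => integrable_gaussBump hl (a i)

lemma integrable_bumpSum_mul_exp_neg {l : ℝ} (hl : 0 < l) (a : ι → V) :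
    Integrable (fun w => bumpSum l a w * exp (-bumpSum l a w)) := by
  refine (integrable_bumpSum hl a).mul_bdd (c := 1)
    (Continuous.aestronglyMeasurable (by fun_prop)) (.of_forall fun w => ?_)
  rw [Real.norm_of_nonneg (exp_pos _).le]
  exact exp_neg_bumpSum_le_one l a w

lemma integrable_exp_neg_bumpSum_mul {l : ℝ} (hl : 0 < l) (a : ι → V) (i : ι) (v : V) :
    Integrable (fun w => exp (-bumpSum l a w) * (gaussBump l (a i) w * inner ℝ (w - a i) v -
        gaussBump l (a i) w * ∑ k, gaussBump l (a k) w * inner ℝ (w - a k) v)) := by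
  have h₁ : Integrable (fun w => exp (-bumpSum l a w) *
      (gaussBump l (a i) w * inner ℝ (w - a i) v)) := by
    refine (integrable_gaussBump_mul_inner hl (a i) v).bdd_mul (c := 1)
      (Continuous.aestronglyMeasurable (by fun_prop)) (.of_forall fun w => ?_)
    rw [Real.norm_of_nonneg (exp_pos _).le]
    exact exp_neg_bumpSum_le_one l a w
  have h₂ : Integrable (fun w => (gaussBump l (a i) w * exp (-bumpSum l a w)) *
      ∑ k, gaussBump l (a k) w * inner ℝ (w - a k) v) := by
    refine (integrable_finsetSum _ fun k _ => integrable_gaussBump_mul_inner hl (a k) v).bdd_mul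
      (c := 1) (Continuous.aestronglyMeasurable (by fun_prop)) (.of_forall fun w => ?_)
    rw [Real.norm_of_nonneg (mul_nonneg (gaussBump_nonneg _ _ _) (exp_pos _).le)]
    exact gaussBump_mul_exp_neg_bumpSum_le_one l a w i
  refine (h₁.sub h₂).congr (.of_forall fun w => ?_)
  simp only [Pi.sub_apply]
  ring

/-- Integration by parts for the directional derivative of a single bump times `exp (-bumpSum)`. -/
lemma integral_exp_neg_bumpSum_mul_eq_zero {l : ℝ} (hl : 0 < l) (a : ι → V) (i : ι) (v : V) :
    ∫ w, exp (-bumpSum l a w) * (gaussBump l (a i) w * inner ℝ (w - a i) v -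
        gaussBump l (a i) w * ∑ k, gaussBump l (a k) w * inner ℝ (w - a k) v) = 0 := by
  have hint : Integrable (fun w => gaussBump l (a i) w * exp (-bumpSum l a w)) := by
    refine (integrable_gaussBump hl (a i)).mul_bdd (c := 1)
      (Continuous.aestronglyMeasurable (by fun_prop)) (.of_forall fun w => ?_)
    rw [Real.norm_of_nonneg (exp_pos _).le]
    exact exp_neg_bumpSum_le_one l a w
  have h := integral_bilinear_hasLineDerivAt_right_eq_neg_left_of_integrable
    (μ := (volume : Measure V)) (B := ContinuousLinearMap.mul ℝ ℝ) (v := v)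
    (f := fun _ => (1 : ℝ)) (f' := fun _ => 0)
    (g := fun w => gaussBump l (a i) w * exp (-bumpSum l a w))
    (g' := fun w => -2 * l * (exp (-bumpSum l a w) * (gaussBump l (a i) w * inner ℝ (w - a i) v -
        gaussBump l (a i) w * ∑ k, gaussBump l (a k) w * inner ℝ (w - a k) v)))
    (by simp) (by simpa using (integrable_exp_neg_bumpSum_mul hl a i v).const_mul (-2 * l))
    (by simpa using hint) (fun w _ => hasDerivAt_const _ _)
    (fun w _ => hasLineDerivAt_gaussBump_mul_exp_neg_bumpSum l a i w v)
  simp only [ContinuousLinearMap.mul_apply', one_mul, zero_mul, integral_zero, neg_zero,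
    integral_const_mul] at h
  simpa [hl.ne'] using h

/-- If points move smoothly and boundedly so that pairwise distances are infinitesimally
nondecreasing, then the integral of `E exp (-E)`, with `E` the sum of the Gaussian bumps around
them, is nondecreasing. -/
theorem integral_bumpSum_mul_exp_neg_monotoneOn {l R T : ℝ} (hl : 0 < l)
    {x x' : ι → ℝ → V} (hx : ∀ i t, HasDerivAt (x i) (x' i t) t)
    (hR : ∀ i t, ‖x i t‖ ≤ R) (hR' : ∀ i t, ‖x' i t‖ ≤ R)
    (hexp : ∀ i k, ∀ t ∈ Ioo 0 T, 0 ≤ inner ℝ (x i t - x k t) (x' i t - x' k t)) :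
    MonotoneOn (fun t => ∫ w, bumpSum l (fun i => x i t) w * exp (-bumpSum l (fun i => x i t) w))
      (Icc 0 T) := by
  set D : ℝ → V → ℝ := fun t w =>
    (1 - bumpSum l (fun i => x i t) w) * exp (-bumpSum l (fun i => x i t) w) *
        ∑ i, 2 * l * (gaussBump l (x i t) w * inner ℝ (w - x i t) (x' i t)) with hD
  set C : ℝ := 2 * (1 + 2 / l) * exp (l + l * R ^ 2 / 2)
  have hbound : ∀ t w, ‖D t w‖ ≤ ∑ _i : ι, 2 * l * (C * exp (-(l / 4) * ‖w‖ ^ 2) * R) := by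
    intro t w
    rw [hD, norm_mul]
    refine (mul_le_of_le_one_left (norm_nonneg _)
      (abs_one_sub_bumpSum_mul_exp_neg_le_one l _ w)).trans ?_
    refine (norm_sum_le _ _).trans (Finset.sum_le_sum fun i _ => ?_)
    rw [norm_mul, norm_mul (gaussBump l (x i t) w), Real.norm_of_nonneg (by positivity),
      Real.norm_of_nonneg (gaussBump_nonneg _ _ _)]
    refine mul_le_mul_of_nonneg_left ?_ (by positivity)
    calc gaussBump l (x i t) w * ‖inner ℝ (w - x i t) (x' i t)‖
        ≤ gaussBump l (x i t) w * ((1 + ‖w - x i t‖) * ‖x' i t‖) := by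
          refine mul_le_mul_of_nonneg_left ?_ (gaussBump_nonneg _ _ _)
          exact (norm_inner_le_norm _ _).trans (by gcongr; linarith)
      _ = gaussBump l (x i t) w * (1 + ‖w - x i t‖) * ‖x' i t‖ := by ring
      _ ≤ _ := by
          have h := gaussBump_mul_one_add_norm_le hl (hR i t) w
          gcongr
          exact hR' i t
  have hderiv : ∀ t, HasDerivAt (fun t => ∫ w, bumpSum l (fun i => x i t) w *
      exp (-bumpSum l (fun i => x i t) w)) (∫ w, D t w) t := fun t =>
    (hasDerivAt_integral_of_dominated_loc_of_deriv_le (s := univ) Filter.univ_mem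
      (.of_forall fun t => (integrable_bumpSum_mul_exp_neg hl _).aestronglyMeasurable)
      (integrable_bumpSum_mul_exp_neg hl _)
      (Continuous.aestronglyMeasurable (by rw [hD]; fun_prop))
      (.of_forall fun w t _ => hbound t w)
      (integrable_finsetSum _ fun i _ => (((integrable_exp_neg_mul_sq_norm
        (by positivity)).const_mul C).mul_const R).const_mul (2 * l))
      (.of_forall fun w t _ => hasDerivAt_bumpSum_mul_exp_neg l (fun i => hx i t) w)).2
  refine monotoneOn_of_deriv_nonneg (convex_Icc 0 T)
    (fun t _ => (hderiv t).continuousAt.continuousWithinAt)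
    (fun t _ => (hderiv t).differentiableAt.differentiableWithinAt) fun t ht => ?_
  rw [interior_Icc] at ht
  rw [(hderiv t).deriv]
  set S : V → ℝ := fun w => exp (-bumpSum l (fun i => x i t) w) *
    ∑ i, ∑ k, gaussBump l (x i t) w * gaussBump l (x k t) w *
      inner ℝ (x i t - x k t) (x' i t - x' k t) with hS
  set P : ι → V → ℝ := fun i w => exp (-bumpSum l (fun i => x i t) w) *
    (gaussBump l (x i t) w * inner ℝ (w - x i t) (x' i t) -
      gaussBump l (x i t) w * ∑ k, gaussBump l (x k t) w * inner ℝ (w - x k t) (x' i t)) with hP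
  have hDS : ∀ w, D t w = 2 * l * ∑ i, P i w + l * S w := fun w => by
    have h := sum_bump_inner_identity (fun i => gaussBump l (x i t) w) (fun i => x i t)
      (fun i => x' i t) w
    simp only [hD, hP, hS, ← Finset.mul_sum]
    rw [show ∀ e b s : ℝ, (1 - b) * e * (2 * l * s) = 2 * l * e * ((1 - b) * s) by intros; ring]
    rw [bumpSum, h]
    ring
  have hPint : Integrable (fun w => 2 * l * ∑ i, P i w) :=
    (integrable_finsetSum _ fun i _ =>
      integrable_exp_neg_bumpSum_mul hl (fun i => x i t) i (x' i t)).const_mul _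
  have hP0 : ∫ w, 2 * l * ∑ i, P i w = 0 := by
    rw [integral_const_mul, integral_finsetSum _ fun i _ =>
      integrable_exp_neg_bumpSum_mul hl (fun i => x i t) i (x' i t)]
    simp only [integral_exp_neg_bumpSum_mul_eq_zero hl (fun i => x i t)]
    simp
  have hDint : Integrable (D t) :=
    (integrable_finsetSum _ fun i _ => (((integrable_exp_neg_mul_sq_norm
        (by positivity)).const_mul C).mul_const R).const_mul (2 * l)).mono'
      (Continuous.aestronglyMeasurable (by rw [hD]; fun_prop)) (.of_forall (hbound t))
  have hint : ∫ w, D t w = ∫ w, l * S w := by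
    rw [← sub_zero (∫ w, D t w), ← hP0, ← integral_sub hDint hPint]
    simp only [hDS, add_sub_cancel_left]
  rw [hint]
  refine integral_nonneg fun w => ?_
  refine mul_nonneg hl.le (mul_nonneg (exp_pos _).le ?_)
  exact Finset.sum_nonneg fun i _ => Finset.sum_nonneg fun k _ =>
    mul_nonneg (mul_nonneg (gaussBump_nonneg _ _ _) (gaussBump_nonneg _ _ _)) (hexp i k t ht)

end Derivative

lemma integral_Ioi_mul_gaussian_mul_exp_neg {l : ℝ} (hl : 0 < l) {A : ℝ} (hA : 0 ≤ A) :
    ∫ r in Ioi (0 : ℝ), r * (A * exp (-l * r ^ 2) * exp (-(A * exp (-l * r ^ 2)))) =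
      (1 - exp (-A)) / (2 * l) := by
  have hd : ∀ r ∈ Ici (0 : ℝ), HasDerivAt (fun r => exp (-(A * exp (-l * r ^ 2))) / (2 * l))
      (r * (A * exp (-l * r ^ 2) * exp (-(A * exp (-l * r ^ 2))))) r := fun r _ => by
    convert! (((((hasDerivAt_pow 2 r).const_mul (-l)).exp.const_mul A).fun_neg).exp.div_const
      (2 * l)) using 1
    field_simp
    push_cast
    ring
  have hint : IntegrableOn (fun r : ℝ =>
      r * (A * exp (-l * r ^ 2) * exp (-(A * exp (-l * r ^ 2))))) (Ioi 0) := by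
    have h := (integrable_mul_exp_neg_mul_sq hl).integrableOn (s := Ioi 0)
    refine Integrable.mono' (h.const_mul A)
      (Continuous.aestronglyMeasurable (by fun_prop)) ?_
    filter_upwards [ae_restrict_mem measurableSet_Ioi] with r hr
    have hr : 0 < r := hr
    rw [Real.norm_of_nonneg (by positivity)]
    have : exp (-(A * exp (-l * r ^ 2))) ≤ 1 := exp_le_one_iff.2 (by
      have : 0 ≤ A * exp (-l * r ^ 2) := by positivity
      linarith)
    calc _ ≤ r * (A * exp (-l * r ^ 2) * 1) := by gcongr
      _ = _ := by ring
  have hlim : Filter.Tendsto (fun r : ℝ => exp (-(A * exp (-l * r ^ 2))) / (2 * l)) Filter.atTop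
      (nhds (exp (-(A * 0)) / (2 * l))) := by
    have h : Filter.Tendsto (fun r : ℝ => exp (-l * r ^ 2)) Filter.atTop (nhds 0) :=
      tendsto_exp_atBot.comp ((Filter.tendsto_pow_atTop two_ne_zero).const_mul_atTop_of_neg
        (neg_neg_of_pos hl))
    exact ((continuous_exp.tendsto _).comp (h.const_mul A).neg).div_const _
  rw [integral_Ioi_of_hasDerivAt_of_tendsto' hd hint hlim]
  simp
  ring

section Plane

variable {ι : Type*} [Fintype ι] {P : Type*} [NormedAddCommGroup P]

lemma bumpSum_toLp_zero_right (l : ℝ) (p : ι → P) (y z : P) :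
    bumpSum l (fun i => WithLp.toLp 2 (p i, (0 : P))) (WithLp.toLp 2 (y, z)) =
      bumpSum l p y * exp (-l * ‖z‖ ^ 2) := by
  simp only [bumpSum, gaussBump, WithLp.prod_norm_sq_eq_of_L2, Finset.sum_mul, ← exp_add]
  refine Finset.sum_congr rfl fun i _ => ?_
  simp
  ring

lemma bumpSum_toLp_zero_left (l : ℝ) (p : ι → P) (y z : P) :
    bumpSum l (fun i => WithLp.toLp 2 ((0 : P), p i)) (WithLp.toLp 2 (z, y)) =
      bumpSum l p y * exp (-l * ‖z‖ ^ 2) := by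
  simp only [bumpSum, gaussBump, WithLp.prod_norm_sq_eq_of_L2, Finset.sum_mul, ← exp_add]
  refine Finset.sum_congr rfl fun i _ => ?_
  simp
  ring

lemma one_sub_exp_neg_bumpSum_le {l : ℝ} (hl : 1 ≤ l) (p : ι → P) (y : P) :
    1 - exp (-bumpSum l p y) ≤ bumpSum 1 p y := by
  by_cases h : ∃ i, ‖y - p i‖ ≤ 1
  · obtain ⟨i, hi⟩ := h
    have h₁ : 1 ≤ gaussBump 1 (p i) y := one_le_exp (by nlinarith [norm_nonneg (y - p i)])
    linarith [gaussBump_le_bumpSum 1 p y i, exp_pos (-bumpSum l p y)]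
  · push Not at h
    have h₁ : bumpSum l p y ≤ bumpSum 1 p y := Finset.sum_le_sum fun i _ =>
      exp_le_exp.2 (mul_le_mul_of_nonpos_right hl (by nlinarith [h i]))
    linarith [add_one_le_exp (-bumpSum l p y)]

lemma tendsto_one_sub_exp_neg_bumpSum (p : ι → P) {y : P} (hy : ∀ i, ‖y - p i‖ ≠ 1) :
    Filter.Tendsto (fun l => 1 - exp (-bumpSum l p y)) Filter.atTop
      (nhds ((⋃ i, closedBall (p i) 1).indicator 1 y)) := by
  by_cases h : ∃ i, ‖y - p i‖ ≤ 1
  · obtain ⟨i, hi⟩ := h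
    have hmem : y ∈ ⋃ i, closedBall (p i) 1 :=
      mem_iUnion.2 ⟨i, by rwa [mem_closedBall, dist_eq_norm]⟩
    have hi := lt_of_le_of_ne hi (hy i)
    have hpos : 0 < 1 - ‖y - p i‖ ^ 2 := by nlinarith [norm_nonneg (y - p i)]
    have hE : Filter.Tendsto (fun l => bumpSum l p y) Filter.atTop Filter.atTop :=
      Filter.tendsto_atTop_mono (fun l => gaussBump_le_bumpSum l p y i)
        (tendsto_exp_atTop.comp (Filter.tendsto_id.atTop_mul_const hpos))
    rw [indicator_of_mem hmem]
    simpa using (tendsto_exp_neg_atTop_nhds_zero.comp hE).const_sub 1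
  · push Not at h
    have hmem : y ∉ ⋃ i, closedBall (p i) 1 := by
      simpa [dist_eq_norm] using h
    have hE : Filter.Tendsto (fun l => bumpSum l p y) Filter.atTop (nhds (∑ _i : ι, 0)) :=
      tendsto_finsetSum _ fun i _ => tendsto_exp_atBot.comp
        (Filter.tendsto_id.atTop_mul_const_of_neg (by nlinarith [h i]))
    rw [indicator_of_notMem hmem]
    simpa using ((continuous_exp.tendsto _).comp hE.neg).const_sub 1

variable [InnerProductSpace ℝ P] [FiniteDimensional ℝ P] [MeasurableSpace P] [BorelSpace P]

lemma integral_gaussian_mul_exp_neg (hP : Module.finrank ℝ P = 2) {l : ℝ} (hl : 0 < l) {A : ℝ}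
    (hA : 0 ≤ A) :
    ∫ z : P, A * exp (-l * ‖z‖ ^ 2) * exp (-(A * exp (-l * ‖z‖ ^ 2))) =
      volume.real (ball (0 : P) 1) / l * (1 - exp (-A)) := by
  have : Nontrivial P := Module.nontrivial_of_finrank_pos (R := ℝ) (by omega)
  rw [integral_fun_norm_addHaar volume
    (fun r => A * exp (-l * r ^ 2) * exp (-(A * exp (-l * r ^ 2)))), hP]
  simp only [Nat.add_one_sub_one, pow_one, smul_eq_mul]
  rw [integral_Ioi_mul_gaussian_mul_exp_neg hl hA]
  simp
  field_simp

lemma integral_prod_bumpSum_zero_right (hP : Module.finrank ℝ P = 2) {l : ℝ} (hl : 0 < l)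
    (p : ι → P) :
    ∫ w : WithLp 2 (P × P), bumpSum l (fun i => WithLp.toLp 2 (p i, (0 : P))) w *
        exp (-bumpSum l (fun i => WithLp.toLp 2 (p i, (0 : P))) w) =
      volume.real (ball (0 : P) 1) / l * ∫ y, (1 - exp (-bumpSum l p y)) := by
  have hmp := WithLp.volume_preserving_toLp P P
  have hme : MeasurableEmbedding (WithLp.toLp 2 : P × P → WithLp 2 (P × P)) :=
    (MeasurableEquiv.toLp 2 (P × P)).measurableEmbedding
  have hint := (hmp.integrable_comp_emb hme).2
    (integrable_bumpSum_mul_exp_neg hl (fun i => WithLp.toLp 2 (p i, (0 : P))))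
  rw [← hmp.integral_comp hme]
  refine (integral_prod _ hint).trans ?_
  rw [← integral_const_mul]
  simp only [Function.comp_apply, bumpSum_toLp_zero_right,
    integral_gaussian_mul_exp_neg hP hl (bumpSum_nonneg l p _)]

lemma integral_prod_bumpSum_zero_left (hP : Module.finrank ℝ P = 2) {l : ℝ} (hl : 0 < l)
    (p : ι → P) :
    ∫ w : WithLp 2 (P × P), bumpSum l (fun i => WithLp.toLp 2 ((0 : P), p i)) w *
        exp (-bumpSum l (fun i => WithLp.toLp 2 ((0 : P), p i)) w) =
      volume.real (ball (0 : P) 1) / l * ∫ y, (1 - exp (-bumpSum l p y)) := by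
  have hmp := WithLp.volume_preserving_toLp P P
  have hme : MeasurableEmbedding (WithLp.toLp 2 : P × P → WithLp 2 (P × P)) :=
    (MeasurableEquiv.toLp 2 (P × P)).measurableEmbedding
  have hint := (hmp.integrable_comp_emb hme).2
    (integrable_bumpSum_mul_exp_neg hl (fun i => WithLp.toLp 2 ((0 : P), p i)))
  rw [← hmp.integral_comp hme]
  refine (integral_prod_symm _ hint).trans ?_
  rw [← integral_const_mul]
  simp only [Function.comp_apply, bumpSum_toLp_zero_left,
    integral_gaussian_mul_exp_neg hP hl (bumpSum_nonneg l p _)]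

lemma integral_one_sub_exp_neg_bumpSum_le (hP : Module.finrank ℝ P = 2) {l : ℝ} (hl : 0 < l)
    {p q : ι → P} (hpq : ∀ i k, ‖p i - p k‖ ≤ ‖q i - q k‖) :
    ∫ y, (1 - exp (-bumpSum l p y)) ≤ ∫ y, (1 - exp (-bumpSum l q y)) := by
  set x : ι → ℝ → WithLp 2 (P × P) := fun i t => WithLp.toLp 2 (cos t • p i, sin t • q i) with hx
  set x' : ι → ℝ → WithLp 2 (P × P) :=
    fun i t => WithLp.toLp 2 (-sin t • p i, cos t • q i) with hx'
  set R : ℝ := ∑ i, (‖p i‖ + ‖q i‖)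
  have hsum : ∀ i, ‖p i‖ + ‖q i‖ ≤ R := fun i =>
    Finset.single_le_sum (f := fun i => ‖p i‖ + ‖q i‖) (fun i _ => by positivity)
      (Finset.mem_univ i)
  have hbd : ∀ (c s : ℝ) i, |c| ≤ 1 → |s| ≤ 1 →
      ‖(WithLp.toLp 2 (c • p i, s • q i) : WithLp 2 (P × P))‖ ≤ R := fun c s i hc hs => by
    refine le_trans (abs_le_of_sq_le_sq' ?_ (by positivity)).2 (hsum i)
    rw [WithLp.prod_norm_sq_eq_of_L2]
    change ‖c • p i‖ ^ 2 + ‖s • q i‖ ^ 2 ≤ _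
    simp only [norm_smul, mul_pow, norm_eq_abs]
    have hc2 : |c| ^ 2 ≤ 1 := by nlinarith [abs_nonneg c]
    have hs2 : |s| ^ 2 ≤ 1 := by nlinarith [abs_nonneg s]
    nlinarith [sq_nonneg ‖p i‖, sq_nonneg ‖q i‖,
      mul_nonneg (norm_nonneg (p i)) (norm_nonneg (q i))]
  have hmono := integral_bumpSum_mul_exp_neg_monotoneOn (T := π / 2) hl (x := x) (x' := x')
    (fun i t => ?_) (fun i t => hbd _ _ i (abs_cos_le_one t) (abs_sin_le_one t))
    (fun i t => hbd _ _ i (by simpa using abs_sin_le_one t) (abs_cos_le_one t)) ?_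
  · have h := hmono (left_mem_Icc.2 (by positivity)) (right_mem_Icc.2 (by positivity))
      (by positivity)
    have h₀ : ∀ i, x i 0 = WithLp.toLp 2 (p i, (0 : P)) := fun i => by simp [hx]
    have h₁ : ∀ i, x i (π / 2) = WithLp.toLp 2 ((0 : P), q i) := fun i => by simp [hx]
    simp only [h₀, h₁] at h
    rw [integral_prod_bumpSum_zero_right hP hl, integral_prod_bumpSum_zero_left hP hl] at h
    refine le_of_mul_le_mul_left h (div_pos ?_ hl)
    exact ENNReal.toReal_pos (measure_ball_pos _ _ one_pos).ne' measure_ball_lt_top.ne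
  · exact (WithLp.prodContinuousLinearEquiv 2 ℝ P P).symm.hasFDerivAt.comp_hasDerivAt t
      (((hasDerivAt_cos t).smul_const (p i)).prodMk ((hasDerivAt_sin t).smul_const (q i)))
  · intro i k t ht
    have hc := cos_pos_of_mem_Ioo ⟨by linarith [ht.1, pi_pos], ht.2⟩
    have hs := sin_pos_of_pos_of_lt_pi ht.1 (by linarith [ht.2, pi_pos])
    have h : inner ℝ (x i t - x k t) (x' i t - x' k t) =
        sin t * cos t * (‖q i - q k‖ ^ 2 - ‖p i - p k‖ ^ 2) := by
      simp only [hx, hx', ← WithLp.toLp_sub, Prod.mk_sub_mk, WithLp.prod_inner_apply, ← smul_sub,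
        inner_smul_left, inner_smul_right, real_inner_self_eq_norm_sq]
      simp
      ring
    rw [h]
    have := pow_le_pow_left₀ (norm_nonneg _) (hpq i k) 2
    exact mul_nonneg (by positivity) (by linarith)

lemma tendsto_integral_one_sub_exp_neg_bumpSum [Nontrivial P] (p : ι → P) :
    Filter.Tendsto (fun l => ∫ y, (1 - exp (-bumpSum l p y))) Filter.atTop
      (nhds (volume.real (⋃ i, closedBall (p i) 1))) := by
  rw [← integral_indicator_one (MeasurableSet.iUnion fun i => measurableSet_closedBall)]
  refine tendsto_integral_filter_of_dominated_convergence (bumpSum 1 p)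
    (.of_forall fun l => Continuous.aestronglyMeasurable (by fun_prop)) ?_
    (integrable_bumpSum one_pos p) ?_
  · filter_upwards [Filter.eventually_ge_atTop 1] with l hl
    refine .of_forall fun y => ?_
    rw [Real.norm_of_nonneg (by linarith [exp_neg_bumpSum_le_one l p y])]
    exact one_sub_exp_neg_bumpSum_le hl p y
  · have h : ∀ᵐ y : P, ∀ i, y ∉ sphere (p i) 1 :=
      ae_all_iff.2 fun i => measure_eq_zero_iff_ae_notMem.1 (Measure.addHaar_sphere _ _ _)
    filter_upwards [h] with y hy
    exact tendsto_one_sub_exp_neg_bumpSum p fun i => by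
      simpa [dist_eq_norm] using hy i

/-- The Kneser–Poulsen inequality in the plane: if the pairwise distances of the centers do not
decrease, then neither does the area of the union of the unit disks. -/
theorem volume_iUnion_closedBall_le (hP : Module.finrank ℝ P = 2) {p q : ι → P}
    (hpq : ∀ i k, ‖p i - p k‖ ≤ ‖q i - q k‖) :
    volume (⋃ i, closedBall (p i) 1) ≤ volume (⋃ i, closedBall (q i) 1) := by
  have : Nontrivial P := Module.nontrivial_of_finrank_pos (R := ℝ) (by omega)
  have hfin : ∀ a : ι → P, volume (⋃ i, closedBall (a i) 1) ≠ ⊤ := fun a =>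
    ((measure_iUnion_fintype_le _ _).trans_lt
      (ENNReal.sum_lt_top.2 fun i _ => measure_closedBall_lt_top)).ne
  rw [← ENNReal.toReal_le_toReal (hfin p) (hfin q)]
  refine le_of_tendsto_of_tendsto (tendsto_integral_one_sub_exp_neg_bumpSum p)
    (tendsto_integral_one_sub_exp_neg_bumpSum q) ?_
  filter_upwards [Filter.eventually_gt_atTop 0] with l hl
  exact integral_one_sub_exp_neg_bumpSum_le hP hl hpq

end Plane

/-- Bollobás's theorem: if a finite collection of points in the plane moves
continuously so that all pairwise distances are nondecreasing in time, then the
area of the union of the closed unit disks centered at the points is a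
nondecreasing function of time; in particular the area at time `0` is at most
the area at time `1`. -/
theorem area_union_unitDisks_monotone_of_expanding
    (n : ℕ) (x : Fin n → ℝ → EuclideanSpace ℝ (Fin 2))
    (hcont : ∀ i, ContinuousOn (x i) (Icc 0 1))
    (hexp : ∀ i j, MonotoneOn (fun t => ‖x i t - x j t‖) (Icc 0 1)) :
    MonotoneOn (fun t => volume (⋃ i, closedBall (x i t) 1)) (Icc 0 1) ∧
      volume (⋃ i, closedBall (x i 0) 1) ≤ volume (⋃ i, closedBall (x i 1) 1) := by
  have h : MonotoneOn (fun t => volume (⋃ i, closedBall (x i t) 1)) (Icc 0 1) :=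
    fun s hs t ht hst => volume_iUnion_closedBall_le finrank_euclideanSpace_fin
      fun i k => hexp i k hs ht hst
  exact ⟨h, h (left_mem_Icc.2 zero_le_one) (right_mem_Icc.2 zero_le_one) zero_le_one⟩
end

section
/- Let r > 0, let x₁, …, x_ℓ ∈ ℝ², and let C = ⋃_{i=1}^{ℓ} D_{2r}(xᵢ) be the union of the closed disks of radius 2r centered at these points. Then (1/2)·∫_C ∫_C 1{‖x − y‖ ≤ 2r} dx dy ≥ (1/2)·(Area(C)/(4πr²))·∫_{D_{2r}(0)} ∫_{D_{2r}(0)} 1{‖x − y‖ ≤ 2r} dx dy, where all integrals are with respect to two-dimensional Lebesgue measure. -/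
open MeasureTheory Metric Real

section StarShaped

variable {E : Type*} [NormedAddCommGroup E] [InnerProductSpace ℝ E] [FiniteDimensional ℝ E]
  [MeasurableSpace E] [BorelSpace E]

open scoped Pointwise in
/-- The density of a star-shaped subset of a ball is at least as large on smaller concentric sets
that are unions of centered balls. -/
lemma volume_mul_volume_le_of_starShaped {R : ℝ} (hR : 0 < R) {S A : Set E}
    (hSR : S ⊆ closedBall 0 R)
    (hS : ∀ y ∈ S, ∀ c : ℝ, 0 ≤ c → c ≤ 1 → c • y ∈ S)
    (hA : ∀ y ∈ A, ∀ z : E, ‖z‖ ≤ ‖y‖ → z ∈ A) :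
    volume S * volume (A ∩ closedBall (0 : E) R) ≤
      volume (A ∩ S) * volume (closedBall (0 : E) R) := by
  rcases (A ∩ closedBall (0 : E) R).eq_empty_or_nonempty with he | hne
  · simp [he]
  set N : Set ℝ := norm '' (A ∩ closedBall (0 : E) R)
  have hNne : N.Nonempty := hne.image _
  have hNR : ∀ t ∈ N, t ≤ R := by
    rintro _ ⟨y, hy, rfl⟩
    simpa using hy.2
  have hbdd : BddAbove N := ⟨R, hNR⟩
  set s := sSup N
  have hsR : s ≤ R := csSup_le hNne hNR
  have hs0 : 0 ≤ s := by
    obtain ⟨_, y, hy, rfl⟩ := hNne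
    exact (norm_nonneg y).trans (le_csSup hbdd ⟨y, hy, rfl⟩)
  have hball : ball (0 : E) s ⊆ A := by
    intro z hz
    obtain ⟨_, ⟨y, hy, rfl⟩, hlt⟩ := exists_lt_of_lt_csSup hNne (by simpa using hz : ‖z‖ < s)
    exact hA y hy.1 z hlt.le
  have hsub : A ∩ closedBall (0 : E) R ⊆ closedBall 0 s := by
    intro y hy
    simpa using le_csSup hbdd ⟨y, hy, rfl⟩
  have hratio : 0 ≤ s / R := div_nonneg hs0 hR.le
  have hratio' : s / R ≤ 1 := (div_le_one hR).2 hsR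
  have hclosed : volume (closedBall (0 : E) s) =
      ENNReal.ofReal ((s / R) ^ Module.finrank ℝ E) * volume (closedBall (0 : E) R) := by
    rw [← abs_of_nonneg (pow_nonneg hratio _), ← Measure.addHaar_smul,
      smul_closedBall _ _ hR.le, smul_zero, Real.norm_of_nonneg hratio, div_mul_cancel₀ _ hR.ne']
  have hscaled : ENNReal.ofReal ((s / R) ^ Module.finrank ℝ E) * volume S ≤ volume (A ∩ S) := by
    rcases hs0.eq_or_lt with h0 | hpos
    · have h0A : (0 : E) ∈ A := by
        obtain ⟨y, hy⟩ := hne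
        exact hA y hy.1 0 (by simp)
      rw [← abs_of_nonneg (pow_nonneg hratio _), ← Measure.addHaar_smul]
      refine measure_mono ?_
      rintro _ ⟨y, hy, rfl⟩
      have := hS y hy _ hratio hratio'
      refine ⟨?_, this⟩
      simpa [← h0] using h0A
    calc ENNReal.ofReal ((s / R) ^ Module.finrank ℝ E) * volume S
        = volume ((s / R) • S) := by
          rw [Measure.addHaar_smul, abs_of_nonneg (pow_nonneg hratio _)]
      _ ≤ volume ((A ∩ S) ∪ sphere (0 : E) s) := by
          refine measure_mono ?_
          rintro _ ⟨y, hy, rfl⟩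
          have hmem := hS y hy _ hratio hratio'
          have hle : ‖(s / R) • y‖ ≤ s := by
            have hyR : ‖y‖ ≤ R := by simpa using hSR hy
            rw [norm_smul, Real.norm_of_nonneg hratio]
            calc s / R * ‖y‖ ≤ s / R * R := by gcongr
              _ = s := div_mul_cancel₀ _ hR.ne'
          rcases hle.eq_or_lt with heq | hlt
          · exact Or.inr (by simpa using heq)
          · exact Or.inl ⟨hball (by simpa using hlt), hmem⟩
      _ ≤ volume (A ∩ S) + volume (sphere (0 : E) s) := measure_union_le _ _
      _ = volume (A ∩ S) := by
          rw [Measure.addHaar_sphere_of_ne_zero _ _ hpos.ne', add_zero]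
  calc volume S * volume (A ∩ closedBall (0 : E) R)
      ≤ volume S * volume (closedBall (0 : E) s) := by gcongr
    _ = ENNReal.ofReal ((s / R) ^ Module.finrank ℝ E) * volume S *
        volume (closedBall (0 : E) R) := by rw [hclosed]; ring
    _ ≤ _ := by gcongr

/-- The average over a star-shaped subset of a ball of a radially decreasing function is at least
its average over the ball. -/
lemma volume_mul_lintegral_le_of_starShaped {R : ℝ} (hR : 0 < R) {S : Set E}
    (hSR : S ⊆ closedBall 0 R)
    (hS : ∀ y ∈ S, ∀ c : ℝ, 0 ≤ c → c ≤ 1 → c • y ∈ S)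
    {f : E → ℝ} (hf0 : ∀ y, 0 ≤ f y) (hfm : Measurable f)
    (hf : ∀ y z : E, ‖z‖ ≤ ‖y‖ → f y ≤ f z) :
    volume S * ∫⁻ y in closedBall (0 : E) R, ENNReal.ofReal (f y) ≤
      (∫⁻ y in S, ENNReal.ofReal (f y)) * volume (closedBall (0 : E) R) := by
  have hmeas : ∀ μ : Measure E, Measurable fun t : ℝ => μ {a | t < f a} := fun μ =>
    Antitone.measurable fun _ _ hst => measure_mono fun _ ha => lt_of_le_of_lt hst ha
  rw [lintegral_eq_lintegral_meas_lt _ (.of_forall hf0) hfm.aemeasurable,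
    lintegral_eq_lintegral_meas_lt _ (.of_forall hf0) hfm.aemeasurable,
    ← lintegral_const_mul _ (hmeas _), ← lintegral_mul_const _ (hmeas _)]
  refine lintegral_mono fun t => ?_
  have hm : MeasurableSet {a | t < f a} := measurableSet_lt measurable_const hfm
  rw [Measure.restrict_apply hm, Measure.restrict_apply hm]
  exact volume_mul_volume_le_of_starShaped hR hSR hS fun y hy z hz => lt_of_lt_of_le hy (hf y z hz)

/-- The volume of the intersection of two balls of equal radii decreases with the distance of
their centers. -/
lemma volume_closedBall_inter_closedBall_anti (R : ℝ) {y z : E} (h : ‖z‖ ≤ ‖y‖) :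
    volume (closedBall (0 : E) R ∩ closedBall y R) ≤
      volume (closedBall (0 : E) R ∩ closedBall z R) := by
  rcases eq_or_ne y 0 with rfl | hy
  · have : z = 0 := by simpa using h
    rw [this]
  have hy' : 0 < ‖y‖ := norm_pos_iff.2 hy
  set c := ‖z‖ / ‖y‖ with hc
  have hc0 : 0 ≤ c := by positivity
  have hc1 : c ≤ 1 := (div_le_one hy').2 h
  have hnorm : ‖c • y‖ = ‖z‖ := by
    rw [norm_smul, Real.norm_of_nonneg hc0, hc, div_mul_cancel₀ _ hy'.ne']
  calc volume (closedBall (0 : E) R ∩ closedBall y R)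
      ≤ volume ((fun w => w + ((c - 1) / 2) • y) ⁻¹' (closedBall 0 R ∩ closedBall (c • y) R)) := by
        have hcomb : ∀ t : ℝ, 0 ≤ t → t ≤ 1 → ∀ w : E, ‖w‖ ≤ R → ‖w - y‖ ≤ R →
            ‖w - t • y‖ ≤ R := fun t ht0 ht1 w hw hwy => by
          have heq : w - t • y = (1 - t) • w + t • (w - y) := by module
          rw [heq]
          simpa using convex_closedBall (0 : E) R (by simpa using hw) (by simpa using hwy)
            (sub_nonneg.2 ht1) ht0 (by ring)
        refine measure_mono fun w hw => ?_
        have hw0 : ‖w‖ ≤ R := by simpa using hw.1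
        have hwy : ‖w - y‖ ≤ R := by simpa [dist_eq_norm] using hw.2
        refine ⟨?_, ?_⟩
        · have heq : w + ((c - 1) / 2) • y = w - ((1 - c) / 2) • y := by module
          rw [mem_closedBall_zero_iff]
          beta_reduce
          rw [heq]
          exact hcomb _ (by linarith) (by linarith) w hw0 hwy
        · have heq : w + ((c - 1) / 2) • y - c • y = w - ((1 + c) / 2) • y := by module
          rw [mem_closedBall, dist_eq_norm, heq]
          exact hcomb _ (by linarith) (by linarith) w hw0 hwy
    _ = volume (closedBall (0 : E) R ∩ closedBall (c • y) R) := measure_preimage_add_right _ _ _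
    _ = volume (closedBall (0 : E) R ∩ closedBall z R) := by
        set T := Submodule.reflection (ℝ ∙ (c • y - z))ᗮ
        have hT : T (c • y) = z := Submodule.reflection_sub hnorm
        rw [← T.measurePreserving.measure_preimage (s := closedBall 0 R ∩ closedBall z R)
          (isClosed_closedBall.inter isClosed_closedBall).measurableSet.nullMeasurableSet]
        congr 1
        ext w
        have hdist : dist (T w) z = dist w (c • y) := by rw [← hT, T.dist_map]
        rw [Set.mem_preimage, Set.mem_inter_iff, Set.mem_inter_iff, mem_closedBall_zero_iff,
          mem_closedBall_zero_iff, T.norm_map, mem_closedBall, mem_closedBall, hdist]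

lemma measurable_volume_inter_closedBall {B : Set E} (hB : MeasurableSet B) (R : ℝ) :
    Measurable fun y : E => volume (B ∩ closedBall y R) := by
  have hm : MeasurableSet {p : E × E | p.2 ∈ B ∧ dist p.2 p.1 ≤ R} :=
    (measurable_snd hB).inter
      (isClosed_le (continuous_snd.dist continuous_fst) continuous_const).measurableSet
  exact measurable_measure_prodMk_left hm

/-- For a ball `B` centered at the origin, the average over `y` in a star-shaped subset of `B` of
the volume of `B ∩ closedBall y R` is at least its average over `B`. -/
lemma volume_mul_lintegral_volume_inter_le {R : ℝ} (hR : 0 < R) {S : Set E}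
    (hSR : S ⊆ closedBall 0 R)
    (hS : ∀ y ∈ S, ∀ c : ℝ, 0 ≤ c → c ≤ 1 → c • y ∈ S) :
    volume S * ∫⁻ y in closedBall (0 : E) R, volume (closedBall (0 : E) R ∩ closedBall y R) ≤
      (∫⁻ y in S, volume (closedBall (0 : E) R ∩ closedBall y R)) *
        volume (closedBall (0 : E) R) := by
  have hfin : ∀ y : E, volume (closedBall (0 : E) R ∩ closedBall y R) ≠ ⊤ := fun y =>
    measure_ne_top_of_subset Set.inter_subset_left measure_closedBall_lt_top.ne
  have := volume_mul_lintegral_le_of_starShaped hR hSR hS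
    (f := fun y => (volume (closedBall (0 : E) R ∩ closedBall y R)).toReal)
    (fun _ => ENNReal.toReal_nonneg)
    (measurable_volume_inter_closedBall measurableSet_closedBall R).ennreal_toReal
    (fun y z h => ENNReal.toReal_mono (hfin z) (volume_closedBall_inter_closedBall_anti R h))
  simpa only [ENNReal.ofReal_toReal (hfin _)] using this

end StarShaped

section Cells

variable {E : Type*} [NormedAddCommGroup E] {ℓ : ℕ}

/-- The Voronoi cell of `x i`, cut off at distance `R`, with ties broken in favor of the smaller
index. -/
def truncatedVoronoiCell (R : ℝ) (x : Fin ℓ → E) (i : Fin ℓ) : Set E :=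
  {y | ‖y - x i‖ ≤ R ∧ (∀ j < i, ‖y - x i‖ < ‖y - x j‖) ∧ ∀ j, ‖y - x i‖ ≤ ‖y - x j‖}

lemma iUnion_truncatedVoronoiCell (R : ℝ) (x : Fin ℓ → E) :
    ⋃ i, truncatedVoronoiCell R x i = ⋃ i, closedBall (x i) R := by
  apply Set.Subset.antisymm
  · refine Set.iUnion_mono fun i y hy => ?_
    simpa [dist_eq_norm] using hy.1
  · intro y hy
    obtain ⟨k, hk⟩ := Set.mem_iUnion.1 hy
    rw [mem_closedBall, dist_eq_norm] at hk
    obtain ⟨i, -, hi⟩ := Finset.exists_min_image Finset.univ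
      (fun i => toLex (‖y - x i‖, i)) ⟨k, Finset.mem_univ k⟩
    have hle : ∀ j, ‖y - x i‖ ≤ ‖y - x j‖ := fun j => by
      rcases Prod.Lex.le_iff.1 (hi j (Finset.mem_univ j)) with h | h
      exacts [h.le, h.1.le]
    refine Set.mem_iUnion.2 ⟨i, (hle k).trans hk, fun j hj => ?_, hle⟩
    rcases Prod.Lex.le_iff.1 (hi j (Finset.mem_univ j)) with h | h
    exacts [h, absurd h.2 (not_le.2 hj)]

lemma pairwise_disjoint_truncatedVoronoiCell (R : ℝ) (x : Fin ℓ → E) :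
    Pairwise (Function.onFun Disjoint (truncatedVoronoiCell R x)) := by
  intro i j hij
  refine Set.disjoint_left.2 fun y hi hj => ?_
  rcases hij.lt_or_gt with h | h
  · exact (hj.2.1 i h).not_ge (hi.2.2 j)
  · exact (hi.2.1 j h).not_ge (hj.2.2 i)

lemma measurableSet_truncatedVoronoiCell [MeasurableSpace E] [BorelSpace E] (R : ℝ)
    (x : Fin ℓ → E) (i : Fin ℓ) : MeasurableSet (truncatedVoronoiCell R x i) := by
  have hc : ∀ j, Continuous fun y : E => ‖y - x j‖ := fun j => by fun_prop
  have heq : truncatedVoronoiCell R x i = {y | ‖y - x i‖ ≤ R} ∩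
      ((⋂ j, ⋂ (_ : j < i), {y | ‖y - x i‖ < ‖y - x j‖}) ∩
        ⋂ j, {y | ‖y - x i‖ ≤ ‖y - x j‖}) := by
    ext y
    simp [truncatedVoronoiCell]
  rw [heq]
  refine (isClosed_le (hc i) continuous_const).measurableSet.inter (.inter ?_ ?_)
  · exact .iInter fun j => .iInter fun _ => (isOpen_lt (hc i) (hc j)).measurableSet
  · exact .iInter fun j => (isClosed_le (hc i) (hc j)).measurableSet

lemma truncatedVoronoiCell_starShaped [NormedSpace ℝ E] {R : ℝ} {x : Fin ℓ → E} {i : Fin ℓ}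
    {u : E} (hu : x i + u ∈ truncatedVoronoiCell R x i) {c : ℝ} (hc0 : 0 ≤ c) (hc1 : c ≤ 1) :
    x i + c • u ∈ truncatedVoronoiCell R x i := by
  obtain ⟨hR, hlt, hle⟩ := hu
  simp only [add_sub_cancel_left] at hR hlt hle
  have hnorm : ‖c • u‖ = ‖u‖ - (1 - c) * ‖u‖ := by
    rw [norm_smul, Real.norm_of_nonneg hc0]; ring
  have htri : ∀ j, ‖x i + u - x j‖ - (1 - c) * ‖u‖ ≤ ‖x i + c • u - x j‖ := fun j => by
    have := norm_add_le (x i + c • u - x j) ((1 - c) • u)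
    rw [norm_smul, Real.norm_of_nonneg (sub_nonneg.2 hc1)] at this
    have heq : x i + c • u - x j + (1 - c) • u = x i + u - x j := by module
    rw [heq] at this
    linarith
  have hnn : 0 ≤ (1 - c) * ‖u‖ := mul_nonneg (sub_nonneg.2 hc1) (norm_nonneg u)
  refine ⟨?_, fun j hj => ?_, fun j => ?_⟩ <;> rw [add_sub_cancel_left, hnorm]
  · linarith
  · linarith [hlt j hj, htri j]
  · linarith [hle j, htri j]

end Cells

/-- The average over a union `C` of balls of radius `R` of the volume of `C` near a point is at
least the corresponding average for a single ball. -/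
lemma volume_mul_lintegral_volume_inter_le_of_iUnion_closedBall {E : Type*} [NormedAddCommGroup E]
    [InnerProductSpace ℝ E] [FiniteDimensional ℝ E] [MeasurableSpace E] [BorelSpace E]
    {R : ℝ} (hR : 0 < R) {ℓ : ℕ} (x : Fin ℓ → E) :
    volume (⋃ i, closedBall (x i) R) *
        ∫⁻ y in closedBall (0 : E) R, volume (closedBall (0 : E) R ∩ closedBall y R) ≤
      (∫⁻ y in ⋃ i, closedBall (x i) R, volume ((⋃ i, closedBall (x i) R) ∩ closedBall y R)) *
        volume (closedBall (0 : E) R) := by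
  set C := ⋃ i, closedBall (x i) R with hC
  have hcell := measurableSet_truncatedVoronoiCell R x
  have hdisj := pairwise_disjoint_truncatedVoronoiCell R x
  have hvol : volume C = ∑ i, volume (truncatedVoronoiCell R x i) := by
    rw [hC, ← iUnion_truncatedVoronoiCell, measure_iUnion hdisj hcell, tsum_fintype]
  have hint : ∫⁻ y in C, volume (C ∩ closedBall y R) =
      ∑ i, ∫⁻ y in truncatedVoronoiCell R x i, volume (C ∩ closedBall y R) := by
    conv_lhs => rw [hC, ← iUnion_truncatedVoronoiCell]
    rw [lintegral_iUnion hcell hdisj, tsum_fintype, iUnion_truncatedVoronoiCell]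
  rw [hvol, hint, Finset.sum_mul, Finset.sum_mul]
  refine Finset.sum_le_sum fun i _ => ?_
  set S := (fun u => x i + u) ⁻¹' truncatedVoronoiCell R x i
  have hS : volume S = volume (truncatedVoronoiCell R x i) := measure_preimage_add _ _ _
  have hshift := (measurePreserving_add_left (volume : Measure E) (x i)).setLIntegral_comp_preimage
    (hcell i) (measurable_volume_inter_closedBall
      (B := C) (MeasurableSet.iUnion fun i => measurableSet_closedBall) R)
  rw [← hS, ← hshift]
  refine (volume_mul_lintegral_volume_inter_le hR (S := S) ?_ ?_).trans ?_
  · intro u hu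
    simpa using hu.1
  · intro u hu c hc0 hc1
    exact truncatedVoronoiCell_starShaped hu hc0 hc1
  · refine mul_le_mul_left (lintegral_mono fun u => ?_) _
    calc volume (closedBall (0 : E) R ∩ closedBall u R)
        ≤ volume ((fun w => x i + w) ⁻¹' (C ∩ closedBall (x i + u) R)) := by
          refine measure_mono fun w hw => ⟨Set.mem_iUnion.2 ⟨i, ?_⟩, ?_⟩
          · simpa using hw.1
          · simpa using hw.2
      _ = _ := measure_preimage_add _ _ _

/-- The Bochner double integral of the indicator of close pairs as a lower Lebesgue integral. -/
lemma setIntegral_setIntegral_indicator_eq {E : Type*} [NormedAddCommGroup E]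
    [InnerProductSpace ℝ E] [FiniteDimensional ℝ E] [MeasurableSpace E] [BorelSpace E]
    {B : Set E} (hB : MeasurableSet B) (hfin : volume B ≠ ⊤) (R : ℝ) :
    ∫ x in B, ∫ y in B, (if ‖x - y‖ ≤ R then (1 : ℝ) else 0) =
      (∫⁻ x in B, volume (B ∩ closedBall x R)).toReal := by
  rw [← integral_toReal (measurable_volume_inter_closedBall hB R).aemeasurable
    (.of_forall fun x => (measure_mono Set.inter_subset_left).trans_lt hfin.lt_top)]
  refine integral_congr_ae (.of_forall fun x => ?_)
  have heq : (fun y => if ‖x - y‖ ≤ R then (1 : ℝ) else 0) =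
      (closedBall x R).indicator fun _ => 1 := by
    ext y
    simp [Set.indicator, dist_eq_norm, norm_sub_rev]
  simp only [heq]
  rw [integral_indicator_const _ measurableSet_closedBall, smul_eq_mul, mul_one,
    measureReal_restrict_apply measurableSet_closedBall, Set.inter_comm]
  rfl

/-- The geometric lemma: for `C` a finite union of disks of radius `2r` in the plane,
`(1/2)·∫_C ∫_C 1{‖x−y‖ ≤ 2r}` is at least `(1/2)·(Area C)/(4πr²)` times the
corresponding integral over `D_{2r}(0) × D_{2r}(0)`. -/
theorem integral_pairs_ge_of_union_disks
    (r : ℝ) (hr : 0 < r) (ℓ : ℕ) (x : Fin ℓ → EuclideanSpace ℝ (Fin 2))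
    (C : Set (EuclideanSpace ℝ (Fin 2))) (hC : C = ⋃ i, closedBall (x i) (2 * r)) :
    (1 / 2) * ∫ x in C, ∫ y in C, (if ‖x - y‖ ≤ 2 * r then (1 : ℝ) else 0) ≥
      (1 / 2) * ((volume C).toReal / (4 * π * r ^ 2)) *
        ∫ x in closedBall (0 : EuclideanSpace ℝ (Fin 2)) (2 * r),
          ∫ y in closedBall (0 : EuclideanSpace ℝ (Fin 2)) (2 * r),
            (if ‖x - y‖ ≤ 2 * r then (1 : ℝ) else 0) := by
  have hR : 0 < 2 * r := by positivity
  have hCm : MeasurableSet C := hC ▸ MeasurableSet.iUnion fun i => measurableSet_closedBall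
  have hCfin : volume C ≠ ⊤ := by
    rw [hC]
    exact ((measure_iUnion_fintype_le _ _).trans_lt
      (ENNReal.sum_lt_top.2 fun i _ => measure_closedBall_lt_top)).ne
  have hint : ∫⁻ y in C, volume (C ∩ closedBall y (2 * r)) ≠ ⊤ := by
    refine ((lintegral_mono fun y => measure_mono Set.inter_subset_left).trans_lt
      (?_ : ∫⁻ _ in C, volume C < ⊤)).ne
    rw [setLIntegral_const]
    exact ENNReal.mul_lt_top hCfin.lt_top hCfin.lt_top
  have hD : (volume (closedBall (0 : EuclideanSpace ℝ (Fin 2)) (2 * r))).toReal =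
      4 * π * r ^ 2 := by
    rw [EuclideanSpace.volume_closedBall_fin_two, ENNReal.toReal_mul, ENNReal.toReal_pow,
      ENNReal.toReal_ofReal hR.le]
    rw [ENNReal.toReal_ofReal pi_pos.le]
    ring
  have key := volume_mul_lintegral_volume_inter_le_of_iUnion_closedBall hR x
  rw [← hC] at key
  have key' := ENNReal.toReal_mono (ENNReal.mul_ne_top hint measure_closedBall_lt_top.ne) key
  rw [ENNReal.toReal_mul, ENNReal.toReal_mul, hD] at key'
  rw [setIntegral_setIntegral_indicator_eq hCm hCfin,
    setIntegral_setIntegral_indicator_eq measurableSet_closedBall measure_closedBall_lt_top.ne,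
    ge_iff_le, mul_assoc, div_mul_eq_mul_div (volume C).toReal]
  have hpos : 0 < 4 * π * r ^ 2 := by positivity
  refine mul_le_mul_of_nonneg_left ?_ (by norm_num)
  rwa [div_le_iff₀ hpos]
end

section
/- Let R > 0 and let x, y ∈ ℝ² with ‖x‖ ≤ ‖y‖. Then Area(D_R(0) ∩ D_R(y)) ≤ Area(D_R(0) ∩ D_R(x)); that is, the area of intersection of two closed disks of equal radius R in the plane is a nonincreasing function of the distance between their centers. -/
open MeasureTheory Metric Real

section Overlap

variable {E : Type*} [NormedAddCommGroup E] [InnerProductSpace ℝ E]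

/-- Symmetrically placed balls overlap more when their centers are scaled towards the origin. -/
theorem closedBall_neg_inter_closedBall_subset_smul (R : ℝ) (v : E) {c : ℝ}
    (hc : c ∈ Set.Icc (0 : ℝ) 1) :
    closedBall (-v) R ∩ closedBall v R ⊆ closedBall (-(c • v)) R ∩ closedBall (c • v) R := by
  rintro z ⟨h₁, h₂⟩
  rw [mem_closedBall_comm] at h₁ h₂
  have key : ∀ t ∈ Set.Icc (0 : ℝ) 1, (1 - t) • (-v) + t • v ∈ closedBall z R := fun t ht =>
    convex_closedBall z R h₁ h₂ (sub_nonneg.2 ht.2) ht.1 (sub_add_cancel 1 t)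
  obtain ⟨hc₀, hc₁⟩ := hc
  constructor <;> rw [mem_closedBall_comm]
  · convert key ((1 - c) / 2) ⟨by linarith, by linarith⟩ using 1
    module
  · convert key ((1 + c) / 2) ⟨by linarith, by linarith⟩ using 1
    module

variable [FiniteDimensional ℝ E] [MeasurableSpace E] [BorelSpace E]

/-- The volume of the overlap of two balls of equal radius depends only on the distance
between their centers. -/
theorem volume_closedBall_zero_inter_closedBall_eq_of_norm_eq (R : ℝ) {x y : E}
    (h : ‖x‖ = ‖y‖) :
    volume (closedBall (0 : E) R ∩ closedBall x R) =
      volume (closedBall (0 : E) R ∩ closedBall y R) := by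
  let f : E ≃ₗᵢ[ℝ] E := (Submodule.span ℝ {x - y})ᗮ.reflection
  have hf : f x = y := Submodule.reflection_sub h
  have hpre : f ⁻¹' (closedBall (0 : E) R ∩ closedBall y R) =
      closedBall (0 : E) R ∩ closedBall x R := by
    rw [Set.preimage_inter, ← hf, ← map_zero f]
    simp only [f.preimage_closedBall, f.symm_apply_apply, map_zero]
  rw [← hpre]
  exact f.measurePreserving.measure_preimage
    (measurableSet_closedBall.inter measurableSet_closedBall).nullMeasurableSet

/-- Two balls of equal radius, one centered at the origin, can be placed symmetrically about the
origin without changing the volume of their overlap. -/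
theorem volume_closedBall_zero_inter_closedBall_eq_symmetric (R : ℝ) (v : E) :
    volume (closedBall (0 : E) R ∩ closedBall v R) =
      volume (closedBall (-((1 / 2 : ℝ) • v)) R ∩ closedBall ((1 / 2 : ℝ) • v) R) := by
  rw [← measure_preimage_add_right volume ((1 / 2 : ℝ) • v)]
  congr 1
  ext z
  have hz : z + (1 / 2 : ℝ) • v - v = z - (1 / 2 : ℝ) • v := by module
  simp only [Set.mem_preimage, Set.mem_inter_iff, mem_closedBall, dist_eq_norm, sub_zero, hz,
    sub_neg_eq_add]

/-- Scaling the second center towards the origin increases the volume of the overlap. -/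
theorem volume_closedBall_zero_inter_closedBall_le_smul (R : ℝ) (v : E) {c : ℝ}
    (hc : c ∈ Set.Icc (0 : ℝ) 1) :
    volume (closedBall (0 : E) R ∩ closedBall v R) ≤
      volume (closedBall (0 : E) R ∩ closedBall (c • v) R) := by
  rw [volume_closedBall_zero_inter_closedBall_eq_symmetric,
    volume_closedBall_zero_inter_closedBall_eq_symmetric R (c • v), smul_comm (1 / 2 : ℝ) c v]
  exact measure_mono (closedBall_neg_inter_closedBall_subset_smul R _ hc)

end Overlap

/-- The area of intersection of two closed disks of equal radius `R` in the plane
is a nonincreasing function of the distance between their centers. -/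
theorem overlap_area_antitone_in_distance
    (R : ℝ) (hR : 0 < R) (x y : EuclideanSpace ℝ (Fin 2)) (hxy : ‖x‖ ≤ ‖y‖) :
    volume (closedBall (0 : EuclideanSpace ℝ (Fin 2)) R ∩ closedBall y R) ≤
      volume (closedBall (0 : EuclideanSpace ℝ (Fin 2)) R ∩ closedBall x R) := by
  have hnorm : ‖(‖x‖ / ‖y‖) • y‖ = ‖x‖ := by
    rw [norm_smul, norm_div, norm_norm, norm_norm]
    exact div_mul_cancel_of_imp fun hy => le_antisymm (hy ▸ hxy) (norm_nonneg x)
  rw [← volume_closedBall_zero_inter_closedBall_eq_of_norm_eq R hnorm]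
  exact volume_closedBall_zero_inter_closedBall_le_smul R y
    ⟨by positivity, div_le_one_of_le₀ hxy (norm_nonneg y)⟩
end

section
/- Let x₁, …, xₙ ∈ ℝ² and let 0 < s ≤ R. Then Area(⋃_{i=1}^{n} D_s(xᵢ)) / (πs²) ≥ Area(⋃_{i=1}^{n} D_R(xᵢ)) / (πR²); that is, shrinking the common radius of a finite collection of disks with fixed centers cannot decrease the area of their union relative to the area of a single disk. -/
open MeasureTheory Metric Real

section NearestPointCell

variable {ι E : Type*} [LinearOrder ι]

/-- The Voronoi cell of `x i`, with ties broken in favour of the smallest index. -/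
def nearestPointCell [PseudoMetricSpace E] (x : ι → E) (i : ι) : Set E :=
  {y | (∀ j, dist y (x i) ≤ dist y (x j)) ∧ ∀ j < i, dist y (x i) < dist y (x j)}

lemma pairwise_disjoint_nearestPointCell [PseudoMetricSpace E] (x : ι → E) :
    Pairwise (Function.onFun Disjoint (nearestPointCell x)) := by
  intro i j hij
  refine Set.disjoint_left.2 fun y hi hj => ?_
  rcases hij.lt_or_gt with h | h
  · exact (hj.2 i h).not_ge (hi.1 j)
  · exact (hi.2 j h).not_ge (hj.1 i)

lemma exists_mem_nearestPointCell [PseudoMetricSpace E] [Finite ι] [Nonempty ι]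
    (x : ι → E) (y : E) : ∃ i, y ∈ nearestPointCell x i := by
  obtain ⟨i, hi, hmin⟩ := wellFounded_lt.has_min
    {i | ∀ j, dist y (x i) ≤ dist y (x j)} (Finite.exists_min fun i => dist y (x i))
  refine ⟨i, hi, fun j hj => lt_of_not_ge fun hle => ?_⟩
  exact hmin j (fun k => hle.trans (hi k)) hj

lemma measurableSet_nearestPointCell [PseudoMetricSpace E] [MeasurableSpace E]
    [OpensMeasurableSpace E] [Countable ι] (x : ι → E) (i : ι) :
    MeasurableSet (nearestPointCell x i) := by
  have h : nearestPointCell x i = (⋂ j, {y | dist y (x i) ≤ dist y (x j)}) ∩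
      ⋂ j, ⋂ _ : j < i, {y | dist y (x i) < dist y (x j)} := by
    ext y; simp [nearestPointCell]
  rw [h]
  refine (MeasurableSet.iInter fun j => ?_).inter
    (MeasurableSet.iInter fun j => MeasurableSet.iInter fun _ => ?_)
  · exact (isClosed_le (by fun_prop) (by fun_prop)).measurableSet
  · exact (isOpen_lt (by fun_prop) (by fun_prop)).measurableSet

lemma iUnion_closedBall_eq_iUnion_cell [PseudoMetricSpace E] [Finite ι] (x : ι → E) (r : ℝ) :
    ⋃ i, closedBall (x i) r = ⋃ i, nearestPointCell x i ∩ closedBall (x i) r := by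
  refine Set.Subset.antisymm (fun y hy => ?_) (Set.iUnion_mono fun i => Set.inter_subset_right)
  obtain ⟨k, hk⟩ := Set.mem_iUnion.1 hy
  have : Nonempty ι := ⟨k⟩
  obtain ⟨i, hi⟩ := exists_mem_nearestPointCell x y
  exact Set.mem_iUnion.2 ⟨i, hi, (hi.1 k).trans hk⟩

lemma volume_iUnion_closedBall_eq_sum [PseudoMetricSpace E] [MeasureSpace E]
    [OpensMeasurableSpace E] [Fintype ι] (x : ι → E) (r : ℝ) :
    volume (⋃ i, closedBall (x i) r) =
      ∑ i, volume (nearestPointCell x i ∩ closedBall (x i) r) := by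
  rw [iUnion_closedBall_eq_iUnion_cell, measure_iUnion _ fun i =>
    (measurableSet_nearestPointCell x i).inter measurableSet_closedBall, tsum_fintype]
  exact fun i j hij => (pairwise_disjoint_nearestPointCell x hij).mono
    Set.inter_subset_left Set.inter_subset_left

variable [NormedAddCommGroup E] [NormedSpace ℝ E]

/-- Cells are star-shaped about their centers. -/
lemma homothety_mem_nearestPointCell {x : ι → E} {i : ι} {y : E}
    (hy : y ∈ nearestPointCell x i) {t : ℝ} (ht0 : 0 ≤ t) (ht1 : t ≤ 1) :
    AffineMap.homothety (x i) t y ∈ nearestPointCell x i := by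
  have hcenter : dist (AffineMap.homothety (x i) t y) (x i) = t * dist y (x i) := by
    rw [dist_homothety_center, Real.norm_of_nonneg ht0, dist_comm]
  have hself : dist y (AffineMap.homothety (x i) t y) = (1 - t) * dist y (x i) := by
    rw [dist_self_homothety, Real.norm_of_nonneg (sub_nonneg.2 ht1), dist_comm]
  have htri (j : ι) := dist_triangle y (AffineMap.homothety (x i) t y) (x j)
  refine ⟨fun j => ?_, fun j hj => ?_⟩
  · linarith [htri j, hy.1 j]
  · linarith [htri j, hy.2 j hj]

lemma image_homothety_cell_inter_closedBall_subset (x : ι → E) (i : ι) {s R : ℝ}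
    (hs : 0 < s) (hsR : s ≤ R) :
    AffineMap.homothety (x i) (s / R) '' (nearestPointCell x i ∩ closedBall (x i) R) ⊆
      nearestPointCell x i ∩ closedBall (x i) s := by
  have hR : 0 < R := hs.trans_le hsR
  rintro _ ⟨y, ⟨hy, hyR⟩, rfl⟩
  refine ⟨homothety_mem_nearestPointCell hy (by positivity) ((div_le_one hR).2 hsR), ?_⟩
  rw [mem_closedBall, dist_homothety_center, Real.norm_of_nonneg (by positivity), dist_comm]
  calc s / R * dist y (x i) ≤ s / R * R := by gcongr; exact hyR
    _ = s := div_mul_cancel₀ s hR.ne'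

end NearestPointCell

/-- Shrinking the common radius of a finite family of disks with fixed centers
cannot decrease the area of their union relative to the area of one disk. -/
theorem relative_area_union_ge_of_shrink
    (n : ℕ) (x : Fin n → EuclideanSpace ℝ (Fin 2)) (s R : ℝ) (hs : 0 < s) (hsR : s ≤ R) :
    (volume (⋃ i, closedBall (x i) s)).toReal / (π * s ^ 2) ≥
      (volume (⋃ i, closedBall (x i) R)).toReal / (π * R ^ 2) := by
  have hR : 0 < R := hs.trans_le hsR
  have hle : ENNReal.ofReal ((s / R) ^ 2) * volume (⋃ i, closedBall (x i) R) ≤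
      volume (⋃ i, closedBall (x i) s) := by
    rw [volume_iUnion_closedBall_eq_sum, volume_iUnion_closedBall_eq_sum, Finset.mul_sum]
    refine Finset.sum_le_sum fun i _ => ?_
    have h := measure_mono (μ := volume)
      (image_homothety_cell_inter_closedBall_subset x i hs hsR)
    rwa [Measure.addHaar_image_homothety, finrank_euclideanSpace_fin,
      abs_of_nonneg (by positivity)] at h
  have hfin : volume (⋃ i, closedBall (x i) s) ≠ ⊤ := by
    rw [volume_iUnion_closedBall_eq_sum]
    exact ENNReal.sum_ne_top.2 fun i _ =>
      measure_ne_top_of_subset Set.inter_subset_right measure_closedBall_lt_top.ne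
  have hreal := ENNReal.toReal_mono hfin hle
  rw [ENNReal.toReal_mul, ENNReal.toReal_ofReal (by positivity)] at hreal
  rw [ge_iff_le, le_div_iff₀ (by positivity)]
  calc _ = (s / R) ^ 2 * (volume (⋃ i, closedBall (x i) R)).toReal := by field_simp
    _ ≤ _ := hreal
end

section
/- For every R > 0, the four-dimensional Lebesgue measure of the set {(x, y) ∈ ℝ² × ℝ² : ‖x‖ ≤ R, ‖y‖ ≤ R, ‖x − y‖ ≤ R} equals π(4π − 3√3)R⁴/4. Equivalently, ∫_{D_R(0)} ∫_{D_R(0)} 1{‖x − y‖ ≤ R} dx dy = π(4π − 3√3)R⁴/4. -/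
open MeasureTheory Metric Real

/-- The intersection of the closed unit disks centred at `0` and `1`. -/
def unitLens : Set ℂ := {z | ‖z‖ ≤ 1 ∧ ‖1 - z‖ ≤ 1}

lemma integral_two_mul_sqrt_one_sub_sq_sub_one :
    ∫ s in (-(√3 / 2))..(√3 / 2), (2 * √(1 - s ^ 2) - 1) = 2 * π / 3 - √3 / 2 := by
  have h3 : √3 ^ 2 = 3 := Real.sq_sqrt (by norm_num)
  have h30 : 0 ≤ √3 := Real.sqrt_nonneg _
  have hc : √(1 - (√3 / 2) ^ 2) = 1 / 2 := by
    rw [Real.sqrt_eq_iff_mul_self_eq_of_pos (by norm_num)]; nlinarith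
  have ha : arcsin (√3 / 2) = π / 3 := by
    rw [← Real.sin_pi_div_three]
    exact Real.arcsin_sin (by linarith [Real.pi_pos]) (by linarith [Real.pi_pos])
  have hderiv : ∀ s ∈ Set.uIcc (-(√3 / 2)) (√3 / 2),
      HasDerivAt (fun s ↦ s * √(1 - s ^ 2) + arcsin s - s) (2 * √(1 - s ^ 2) - 1) s := by
    intro s hs
    rw [Set.uIcc_of_le (by linarith)] at hs
    have hs2 : 0 < 1 - s ^ 2 := by nlinarith [hs.1, hs.2]
    have h1 : HasDerivAt (fun s : ℝ ↦ 1 - s ^ 2) (-(2 * s)) s := by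
      simpa using (hasDerivAt_pow 2 s).const_sub 1
    have h2 := ((hasDerivAt_id s).mul (h1.sqrt hs2.ne')).add
      (Real.hasDerivAt_arcsin (x := s) (by nlinarith) (by nlinarith))
    have hq := Real.sq_sqrt hs2.le
    have hq0 := Real.sqrt_pos.2 hs2
    refine (h2.sub (hasDerivAt_id s)).congr_deriv ?_
    simp only [id_eq]
    field_simp
    nlinarith
  rw [intervalIntegral.integral_eq_sub_of_hasDerivAt hderiv
    (Continuous.intervalIntegrable (by fun_prop) _ _)]
  rw [neg_sq, Real.arcsin_neg, hc, ha]
  ring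

lemma isClosed_unitLens : IsClosed unitLens :=
  (isClosed_le continuous_norm continuous_const).inter
    (isClosed_le (continuous_const.sub continuous_id).norm continuous_const)

lemma volume_slice_unitLens (s : ℝ) :
    volume {t : ℝ | (⟨t, s⟩ : ℂ) ∈ unitLens} = ENNReal.ofReal (2 * √(1 - s ^ 2) - 1) := by
  have hmem (t : ℝ) : (⟨t, s⟩ : ℂ) ∈ unitLens ↔
      t ^ 2 ≤ 1 - s ^ 2 ∧ (1 - t) ^ 2 ≤ 1 - s ^ 2 := by
    simp only [unitLens, Set.mem_ofPred_eq, ← sq_le_one_iff₀ (norm_nonneg _), Complex.sq_norm,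
      Complex.normSq_apply, Complex.sub_re, Complex.sub_im, Complex.one_re, Complex.one_im]
    constructor <;> rintro ⟨h1, h2⟩ <;> constructor <;> nlinarith
  rcases lt_or_ge (1 - s ^ 2) 0 with h | h
  · have : {t : ℝ | (⟨t, s⟩ : ℂ) ∈ unitLens} = ∅ := by
      ext t
      simp only [Set.mem_ofPred_eq, hmem, Set.mem_empty_iff_false, iff_false]
      rintro ⟨h1, -⟩
      nlinarith [sq_nonneg t]
    rw [this, Real.sqrt_eq_zero_of_nonpos h.le]
    simp
  · have : {t : ℝ | (⟨t, s⟩ : ℂ) ∈ unitLens} = Set.Icc (1 - √(1 - s ^ 2)) √(1 - s ^ 2) := by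
      ext t
      simp only [Set.mem_ofPred_eq, hmem, Real.sq_le h]
      rw [Set.mem_Icc]
      constructor
      · rintro ⟨h1, h2⟩
        constructor <;> linarith
      · rintro ⟨h1, h2⟩
        have : √(1 - s ^ 2) ≤ 1 := Real.sqrt_le_one.2 (by nlinarith [sq_nonneg s])
        constructor <;> constructor <;> linarith
    rw [this, Real.volume_Icc]
    ring_nf

lemma volume_unitLens : volume unitLens = ENNReal.ofReal (2 * π / 3 - √3 / 2) := by
  have h3 : √3 ^ 2 = 3 := Real.sq_sqrt (by norm_num)
  have h30 : 0 ≤ √3 := Real.sqrt_nonneg _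
  have hsm := Complex.volume_preserving_equiv_real_prod.symm
  rw [← hsm.measure_preimage_equiv, Measure.volume_eq_prod, Measure.prod_apply_symm
    (Complex.measurableEquivRealProd.symm.measurable isClosed_unitLens.measurableSet)]
  have hsupp : (fun s : ℝ ↦ ENNReal.ofReal (2 * √(1 - s ^ 2) - 1)) =
      (Set.Icc (-(√3 / 2)) (√3 / 2)).indicator
        fun s ↦ ENNReal.ofReal (2 * √(1 - s ^ 2) - 1) := by
    symm
    rw [Set.indicator_eq_self]
    intro s hs
    rw [Function.mem_support, ne_eq, ENNReal.ofReal_eq_zero, not_le] at hs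
    have : 1 / 2 < √(1 - s ^ 2) := by linarith
    rw [Real.lt_sqrt (by norm_num)] at this
    rw [Set.mem_Icc, ← abs_le]
    exact abs_le_of_sq_le_sq (by nlinarith) (by linarith)
  calc _ = ∫⁻ s : ℝ, ENNReal.ofReal (2 * √(1 - s ^ 2) - 1) :=
        lintegral_congr fun s ↦ volume_slice_unitLens s
    _ = ∫⁻ s in Set.Icc (-(√3 / 2)) (√3 / 2), ENNReal.ofReal (2 * √(1 - s ^ 2) - 1) := by
        rw [hsupp, lintegral_indicator measurableSet_Icc, ← hsupp]
    _ = _ := by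
        rw [← integral_two_mul_sqrt_one_sub_sq_sub_one,
          intervalIntegral.integral_of_le (by linarith), ← integral_Icc_eq_integral_Ioc,
          ofReal_integral_eq_lintegral_ofReal]
        · exact (Continuous.continuousOn (by fun_prop)).integrableOn_Icc
        · refine (ae_restrict_iff' measurableSet_Icc).2 (.of_forall fun s hs ↦ ?_)
          have : 1 / 2 ≤ √(1 - s ^ 2) := Real.le_sqrt_of_sq_le (by nlinarith [hs.1, hs.2])
          simp only [Pi.zero_apply]
          linarith

lemma Complex.volume_image_mul_left (x : ℂ) (s : Set ℂ) :
    volume ((fun z ↦ x * z) '' s) = ENNReal.ofReal (‖x‖ ^ 2) * volume s := by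
  have := Measure.addHaar_image_linearMap volume (LinearMap.mulLeft ℝ x) s
  have hdet : LinearMap.det (LinearMap.mulLeft ℝ x) = ‖x‖ ^ 2 := by
    rw [Complex.sq_norm, ← Algebra.norm_complex_apply, Algebra.norm_apply]
    rfl
  rw [hdet, abs_of_nonneg (by positivity)] at this
  exact this

lemma volume_lens (x : ℂ) :
    volume {y : ℂ | ‖y‖ ≤ ‖x‖ ∧ ‖x - y‖ ≤ ‖x‖} =
      ENNReal.ofReal (‖x‖ ^ 2) * volume unitLens := by
  rcases eq_or_ne x 0 with rfl | hx
  · simp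
  rw [← Complex.volume_image_mul_left]
  congr 1
  have hx' : 0 < ‖x‖ := norm_pos_iff.2 hx
  ext y
  simp only [unitLens, Set.mem_image, Set.mem_ofPred_eq]
  constructor
  · rintro ⟨h1, h2⟩
    refine ⟨y / x, ⟨?_, ?_⟩, by field_simp⟩
    · rw [norm_div]; exact (div_le_one hx').2 h1
    · rw [one_sub_div hx, norm_div]; exact (div_le_one hx').2 h2
  · rintro ⟨z, ⟨h1, h2⟩, rfl⟩
    constructor
    · rw [norm_mul]; nlinarith
    · rw [← mul_one_sub, norm_mul]; nlinarith

/-- A subset of `ℂ × ℂ` whose slices over the first factor lie in spheres is null. -/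
lemma volume_prod_eq_zero_of_subset_sphere {s : Set (ℂ × ℂ)} (hs : MeasurableSet s)
    (c : ℂ → ℂ) (r : ℂ → ℝ) (h : ∀ p ∈ s, ‖p.2 - c p.1‖ = r p.1) : volume s = 0 := by
  rw [Measure.volume_eq_prod, Measure.prod_apply hs, lintegral_eq_zero_of_ae_eq_zero]
  refine .of_forall fun x ↦ measure_mono_null (fun y hy ↦ ?_)
    (Measure.addHaar_sphere volume (c x) (r x))
  rw [mem_sphere, dist_eq_norm]
  exact h (x, y) hy

/-- The measure of a subset of `closedBall 0 R × ℂ` whose slice over `x` has area `c ‖x‖²`. -/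
lemma volume_of_volume_slice_eq_sq_norm_mul {s : Set (ℂ × ℂ)} (hs : MeasurableSet s) {R : ℝ}
    (c : ENNReal) (hR : ∀ p ∈ s, ‖p.1‖ ≤ R)
    (hc : ∀ x, ‖x‖ ≤ R → volume (Prod.mk x ⁻¹' s) = ENNReal.ofReal (‖x‖ ^ 2) * c) :
    volume s = (∫⁻ x in closedBall (0 : ℂ) R, ENNReal.ofReal (‖x‖ ^ 2)) * c := by
  rw [Measure.volume_eq_prod, Measure.prod_apply hs, ← lintegral_mul_const _ (by fun_prop),
    ← lintegral_indicator measurableSet_closedBall]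
  refine lintegral_congr fun x ↦ ?_
  by_cases hx : ‖x‖ ≤ R
  · rw [Set.indicator_of_mem (by simpa using hx), hc x hx]
  · rw [Set.indicator_of_notMem (by simpa using hx)]
    exact measure_mono_null (fun y hy ↦ hx (hR _ hy)) measure_empty

lemma lintegral_sq_norm_closedBall {R : ℝ} (hR : 0 ≤ R) :
    (∫⁻ x in closedBall (0 : ℂ) R, ENNReal.ofReal (‖x‖ ^ 2)) =
      ENNReal.ofReal (π * R ^ 4 / 2) := by
  set I := ∫⁻ x in closedBall (0 : ℂ) R, ENNReal.ofReal (‖x‖ ^ 2) with hI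
  set P : Set (ℂ × ℂ) := {p | ‖p.1‖ ≤ R ∧ ‖p.2‖ ≤ ‖p.1‖} with hP
  have hPm : MeasurableSet P := by measurability
  have hball (r : ℝ) (hr : 0 ≤ r) :
      volume (closedBall (0 : ℂ) r) = ENNReal.ofReal (r ^ 2) * ENNReal.ofReal π := by
    rw [Complex.volume_closedBall, ENNReal.ofReal_pow hr, ENNReal.ofReal_eq_coe_nnreal pi_nonneg]
    rfl
  have hPv : volume P = I * ENNReal.ofReal π := by
    refine volume_of_volume_slice_eq_sq_norm_mul hPm _ (fun p hp ↦ hp.1) fun x hx ↦ ?_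
    rw [← hball _ (norm_nonneg x)]
    congr 1
    ext y
    simp [hP, hx]
  have hswap : volume (Prod.swap ⁻¹' P) = volume P :=
    Measure.measurePreserving_swap.measure_preimage hPm.nullMeasurableSet
  have hinter : AEDisjoint volume P (Prod.swap ⁻¹' P) :=
    volume_prod_eq_zero_of_subset_sphere (hPm.inter (measurable_swap hPm)) (fun _ ↦ 0)
      (fun x ↦ ‖x‖) fun p hp ↦ by
        rw [sub_zero]
        exact le_antisymm hp.1.2 hp.2.2
  have hunion : P ∪ Prod.swap ⁻¹' P = closedBall 0 R ×ˢ closedBall 0 R := by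
    ext p
    simp only [hP, Set.mem_union, Set.mem_preimage, Set.mem_ofPred_eq, Prod.fst_swap,
      Prod.snd_swap, Set.mem_prod, mem_closedBall_zero_iff]
    grind
  have hsum := measure_union₀ (measurable_swap hPm).nullMeasurableSet hinter
  rw [hunion, hswap, hPv, Measure.volume_eq_prod, Measure.prod_prod, hball R hR] at hsum
  have hItop : I ≠ ⊤ := by
    rintro h
    rw [h, ENNReal.top_mul (by simp [pi_pos]), top_add] at hsum
    exact ENNReal.mul_ne_top (by finiteness) (by finiteness) hsum
  rw [← ENNReal.ofReal_toReal hItop] at hsum ⊢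
  have hI0 : 0 ≤ I.toReal := ENNReal.toReal_nonneg
  have := pi_pos
  rw [← ENNReal.ofReal_mul hI0, ← ENNReal.ofReal_mul (by positivity),
    ← ENNReal.ofReal_mul (by positivity), ← ENNReal.ofReal_add (by positivity) (by positivity),
    ENNReal.ofReal_eq_ofReal_iff (by positivity) (by positivity)] at hsum
  congr 1
  apply mul_right_cancel₀ pi_ne_zero
  linarith

lemma volume_close_pairs_complex {R : ℝ} (hR : 0 ≤ R) :
    volume {p : ℂ × ℂ | ‖p.1‖ ≤ R ∧ ‖p.2‖ ≤ R ∧ ‖p.1 - p.2‖ ≤ R} =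
      ENNReal.ofReal (π * (4 * π - 3 * √3) * R ^ 4 / 4) := by
  set T : Set (ℂ × ℂ) := {p | ‖p.1‖ ≤ R ∧ ‖p.2‖ ≤ ‖p.1‖ ∧ ‖p.1 - p.2‖ ≤ ‖p.1‖} with hT
  have hTm : MeasurableSet T := by measurability
  have hTv : volume T = ENNReal.ofReal (π * R ^ 4 / 2) * volume unitLens := by
    rw [← lintegral_sq_norm_closedBall hR]
    refine volume_of_volume_slice_eq_sq_norm_mul hTm _ (fun p hp ↦ hp.1) fun x hx ↦ ?_
    rw [← volume_lens]
    congr 1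
    ext y
    simp [hT, hx]
  have hswap : MeasurePreserving (Prod.swap : ℂ × ℂ → ℂ × ℂ) := Measure.measurePreserving_swap
  have hsub : MeasurePreserving (fun p : ℂ × ℂ ↦ (p.1 - p.2, -p.2)) :=
    ((MeasurePreserving.id volume).prod (Measure.measurePreserving_neg volume)).comp
      (measurePreserving_sub_prod volume volume)
  set T₂ := (Prod.swap : ℂ × ℂ → ℂ × ℂ) ⁻¹' T with hT₂
  set T₃ := (fun p : ℂ × ℂ ↦ (p.1 - p.2, -p.2)) ⁻¹' T with hT₃
  have hT₂m : MeasurableSet T₂ := hswap.measurable hTm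
  have hT₃m : MeasurableSet T₃ := hsub.measurable hTm
  have mem₂ (p : ℂ × ℂ) : p ∈ T₂ ↔ ‖p.2‖ ≤ R ∧ ‖p.1‖ ≤ ‖p.2‖ ∧ ‖p.1 - p.2‖ ≤ ‖p.2‖ := by
    simp [hT₂, hT, norm_sub_rev]
  have mem₃ (p : ℂ × ℂ) :
      p ∈ T₃ ↔ ‖p.1 - p.2‖ ≤ R ∧ ‖p.2‖ ≤ ‖p.1 - p.2‖ ∧ ‖p.1‖ ≤ ‖p.1 - p.2‖ := by
    simp [hT₃, hT]
  have h₁₂ : AEDisjoint volume T T₂ :=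
    volume_prod_eq_zero_of_subset_sphere (hTm.inter hT₂m) (fun _ ↦ 0) (fun x ↦ ‖x‖)
      fun p ⟨h, h'⟩ ↦ by
        rw [sub_zero]
        exact le_antisymm h.2.1 ((mem₂ p).1 h').2.1
  have h₁₃ : AEDisjoint volume T T₃ :=
    volume_prod_eq_zero_of_subset_sphere (hTm.inter hT₃m) (fun x ↦ x) (fun x ↦ ‖x‖)
      fun p ⟨h, h'⟩ ↦ by
        rw [norm_sub_rev]
        exact le_antisymm h.2.2 ((mem₃ p).1 h').2.2
  have h₂₃ : AEDisjoint volume T₂ T₃ := by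
    rw [AEDisjoint, ← hswap.measure_preimage (hT₂m.inter hT₃m).nullMeasurableSet]
    refine volume_prod_eq_zero_of_subset_sphere (hswap.measurable (hT₂m.inter hT₃m))
      (fun x ↦ x) (fun x ↦ ‖x‖) fun p ⟨h, h'⟩ ↦ ?_
    exact le_antisymm ((mem₂ _).1 h).2.2 ((mem₃ _).1 h').2.1
  have hunion : {p : ℂ × ℂ | ‖p.1‖ ≤ R ∧ ‖p.2‖ ≤ R ∧ ‖p.1 - p.2‖ ≤ R} = T ∪ T₂ ∪ T₃ := by
    ext p
    rw [Set.mem_union, Set.mem_union, mem₂, mem₃]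
    simp only [hT, Set.mem_ofPred_eq]
    grind
  have h3 : √3 ≤ 2 := Real.sqrt_le_iff.2 (by norm_num)
  have hpi := pi_gt_three
  have hlens : 0 ≤ 2 * π / 3 - √3 / 2 := by linarith
  rw [hunion, measure_union₀ hT₃m.nullMeasurableSet (h₁₃.union_left h₂₃),
    measure_union₀ hT₂m.nullMeasurableSet h₁₂, hswap.measure_preimage hTm.nullMeasurableSet,
    hsub.measure_preimage hTm.nullMeasurableSet, hTv, volume_unitLens,
    ← ENNReal.ofReal_mul (by positivity), ← ENNReal.ofReal_add (by positivity) (by positivity),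
    ← ENNReal.ofReal_add (by positivity) (by positivity)]
  congr 1
  ring

/-- The four-dimensional Lebesgue measure of
`{(x, y) : ‖x‖ ≤ R, ‖y‖ ≤ R, ‖x − y‖ ≤ R}` equals `π(4π − 3√3)R⁴/4`; equivalently
`∫_{D_R(0)} ∫_{D_R(0)} 1{‖x − y‖ ≤ R} dx dy = π(4π − 3√3)R⁴/4`. -/
theorem measure_close_pairs_in_disk (R : ℝ) (hR : 0 < R) :
    volume {p : EuclideanSpace ℝ (Fin 2) × EuclideanSpace ℝ (Fin 2) |
        ‖p.1‖ ≤ R ∧ ‖p.2‖ ≤ R ∧ ‖p.1 - p.2‖ ≤ R} =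
      ENNReal.ofReal (π * (4 * π - 3 * Real.sqrt 3) * R ^ 4 / 4) ∧
    (∫ x in closedBall (0 : EuclideanSpace ℝ (Fin 2)) R,
        ∫ y in closedBall (0 : EuclideanSpace ℝ (Fin 2)) R,
          (if ‖x - y‖ ≤ R then (1 : ℝ) else 0)) =
      π * (4 * π - 3 * Real.sqrt 3) * R ^ 4 / 4 := by
  have hvol : volume {p : EuclideanSpace ℝ (Fin 2) × EuclideanSpace ℝ (Fin 2) |
        ‖p.1‖ ≤ R ∧ ‖p.2‖ ≤ R ∧ ‖p.1 - p.2‖ ≤ R} =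
      ENNReal.ofReal (π * (4 * π - 3 * Real.sqrt 3) * R ^ 4 / 4) := by
    have e := Complex.orthonormalBasisOneI.repr.measurePreserving
    have hm : MeasurableSet {p : EuclideanSpace ℝ (Fin 2) × EuclideanSpace ℝ (Fin 2) |
        ‖p.1‖ ≤ R ∧ ‖p.2‖ ≤ R ∧ ‖p.1 - p.2‖ ≤ R} := by measurability
    rw [Measure.volume_eq_prod, ← (e.prod e).measure_preimage hm.nullMeasurableSet,
      ← volume_close_pairs_complex hR.le, Measure.volume_eq_prod]
    congr 1
    ext p
    simp [← map_sub]
  refine ⟨hvol, ?_⟩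
  have hpos : 0 ≤ π * (4 * π - 3 * Real.sqrt 3) * R ^ 4 / 4 := by
    have : √3 ≤ 2 := Real.sqrt_le_iff.2 (by norm_num)
    have := Real.pi_gt_three
    have : 0 ≤ 4 * π - 3 * √3 := by linarith
    positivity
  have hm : MeasurableSet {p : EuclideanSpace ℝ (Fin 2) × EuclideanSpace ℝ (Fin 2) |
      ‖p.1 - p.2‖ ≤ R} := by measurability
  have hite : (fun p : EuclideanSpace ℝ (Fin 2) × EuclideanSpace ℝ (Fin 2) ↦
      if ‖p.1 - p.2‖ ≤ R then (1 : ℝ) else 0) =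
      {p | ‖p.1 - p.2‖ ≤ R}.indicator fun _ ↦ 1 := by
    ext p; simp [Set.indicator]
  rw [← setIntegral_prod (fun p : EuclideanSpace ℝ (Fin 2) × EuclideanSpace ℝ (Fin 2) ↦
      if ‖p.1 - p.2‖ ≤ R then (1 : ℝ) else 0), ← Measure.volume_eq_prod, hite,
    integral_indicator hm, Measure.restrict_restrict hm, setIntegral_const, smul_eq_mul, mul_one,
    ← ENNReal.toReal_ofReal hpos, ← hvol, measureReal_def]
  · congr 2
    ext p
    simp
    tauto
  · rw [hite]
    refine IntegrableOn.indicator (integrableOn_const ?_) hm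
    rw [Measure.prod_prod]
    exact ENNReal.mul_ne_top measure_closedBall_lt_top.ne measure_closedBall_lt_top.ne
end

section
/- Let r > 0, let k be a positive integer, and let X ⊂ ℝ² be a finite set of points with |X| ≤ 2k such that for every x ∈ X there exists x' ∈ X with x' ≠ x and ‖x − x'‖ < 2r. Then Area(⋃_{x ∈ X} D_{2r}(x)) ≤ k·(16π/3 + 2√3)·r². -/
open MeasureTheory Metric Real

/-- The integral of the half-chord length over the vertical extent of the lens cut out by two disks
of radius `R` whose centers are at distance `R`. -/
theorem integral_sqrt_sq_sub_sq_sub_half {R : ℝ} (hR : 0 < R) :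
    ∫ y in (-(√3 / 2 * R))..(√3 / 2 * R), (√(R ^ 2 - y ^ 2) - R / 2) =
      (π / 3 - √3 / 4) * R ^ 2 := by
  have h3 : √3 ^ 2 = 3 := Real.sq_sqrt (by norm_num)
  have h3pos : 0 < √3 := by positivity
  have hlt : √3 / 2 < 1 := by nlinarith
  have hderiv : ∀ y ∈ Set.uIcc (-(√3 / 2 * R)) (√3 / 2 * R),
      HasDerivAt (fun y => (y * √(R ^ 2 - y ^ 2) + R ^ 2 * arcsin (y / R)) / 2 - R / 2 * y)
        (√(R ^ 2 - y ^ 2) - R / 2) y := by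
    intro y hy
    rw [Set.uIcc_of_le (by nlinarith [mul_pos h3pos hR])] at hy
    have hy1 : -R < y := by nlinarith [hy.1]
    have hy2 : y < R := by nlinarith [hy.2]
    have hpos : 0 < R ^ 2 - y ^ 2 := by nlinarith
    have hs : 0 < √(R ^ 2 - y ^ 2) := Real.sqrt_pos.2 hpos
    have hs2 : √(R ^ 2 - y ^ 2) ^ 2 = R ^ 2 - y ^ 2 := Real.sq_sqrt hpos.le
    have hdiv : √(1 - (y / R) ^ 2) = √(R ^ 2 - y ^ 2) / R := by
      rw [show 1 - (y / R) ^ 2 = (R ^ 2 - y ^ 2) / R ^ 2 by field_simp,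
        Real.sqrt_div hpos.le, Real.sqrt_sq hR.le]
    have hne1 : y / R ≠ -1 := by
      rw [Ne, div_eq_iff hR.ne']; linarith
    have hne2 : y / R ≠ 1 := by
      rw [Ne, div_eq_iff hR.ne']; linarith
    have hsqrt : HasDerivAt (fun y => √(R ^ 2 - y ^ 2)) (-(2 * y) / (2 * √(R ^ 2 - y ^ 2))) y := by
      have := ((hasDerivAt_pow 2 y).const_sub (R ^ 2)).sqrt hpos.ne'
      simpa using this
    have harc := (Real.hasDerivAt_arcsin hne1 hne2).comp y ((hasDerivAt_id y).div_const R)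
    have := ((((hasDerivAt_id y).mul hsqrt).add (harc.const_mul (R ^ 2))).div_const 2).sub
      ((hasDerivAt_id y).const_mul (R / 2))
    refine this.congr_deriv ?_
    simp only [id, hdiv]
    field_simp
    linear_combination (-1) * hs2
  rw [intervalIntegral.integral_eq_sub_of_hasDerivAt hderiv
    (Continuous.intervalIntegrable (by fun_prop) _ _)]
  have harc : arcsin (√3 / 2) = π / 3 := by
    rw [← Real.sin_pi_div_three, Real.arcsin_sin] <;> linarith [Real.pi_pos]
  have hsq : √(R ^ 2 - (√3 / 2 * R) ^ 2) = R / 2 := by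
    rw [show R ^ 2 - (√3 / 2 * R) ^ 2 = (R / 2) ^ 2 by ring_nf; rw [h3]; ring,
      Real.sqrt_sq (by positivity)]
  rw [neg_sq, hsq, neg_div, Real.arcsin_neg, mul_div_cancel_right₀ _ hR.ne', harc]
  ring

/-- Two distinct disks of radius `R` with centers at distance at most `R` overlap at least as much
as two disks with centers at distance exactly `R`. -/
theorem volume_real_inter_closedBall_ge {x y : EuclideanSpace ℝ (Fin 2)} {R : ℝ}
    (hne : x ≠ y) (hxy : ‖x - y‖ ≤ R) :
    (2 * π / 3 - √3 / 2) * R ^ 2 ≤ volume.real (closedBall x R ∩ closedBall y R) := by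
  have hd : 0 < ‖x - y‖ := norm_pos_iff.2 (sub_ne_zero.2 hne)
  have hR : 0 < R := hd.trans_le hxy
  have h3 : √3 ^ 2 = 3 := Real.sq_sqrt (by norm_num)
  have h3pos : 0 < √3 := by positivity
  set d := ‖x - y‖ with hd_def
  obtain ⟨b, hb⟩ : ∃ b : OrthonormalBasis (Fin 2) ℝ (EuclideanSpace ℝ (Fin 2)),
      b 1 = d⁻¹ • (x - y) := by
    obtain ⟨b, hb⟩ := Orthonormal.exists_orthonormalBasis_extension_of_card_eq (𝕜 := ℝ)
      (E := EuclideanSpace ℝ (Fin 2)) (ι := Fin 2) (by simp)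
      (v := fun _ => d⁻¹ • (x - y)) (s := {1}) (by
        rw [orthonormal_iff_ite]
        rintro ⟨i, rfl⟩ ⟨j, rfl⟩
        simp only [Set.domRestrict_apply, real_inner_self_eq_norm_sq, norm_smul, norm_inv,
          ← hd_def]
        rw [Real.norm_of_nonneg hd.le, inv_mul_cancel₀ hd.ne', one_pow, if_pos trivial])
    exact ⟨b, hb 1 rfl⟩
  let T : ℝ × ℝ → EuclideanSpace ℝ (Fin 2) := fun p => midpoint ℝ x y + b.repr.symm !₂[p.1, p.2]
  have hT : MeasurePreserving T volume volume := by
    have h1 := (volume_preserving_finTwoArrow ℝ).symm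
    have h2 := (EuclideanSpace.volume_preserving_symm_measurableEquiv_toLp (Fin 2)).symm
    have h3 := b.repr.symm.measurePreserving
    have h4 := measurePreserving_add_left (volume : Measure (EuclideanSpace ℝ (Fin 2)))
      (midpoint ℝ x y)
    exact h4.comp (h3.comp (h2.comp h1))
  have hdist : ∀ (p : ℝ × ℝ) (c : ℝ),
      dist (T p) (midpoint ℝ x y + c • b 1) = √(p.1 ^ 2 + (p.2 - c) ^ 2) := by
    intro p c
    have hc : c • b 1 = b.repr.symm !₂[0, c] := by
      rw [← b.repr_symm_single, ← map_smul]
      congr 1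
      ext i; fin_cases i <;> simp
    rw [hc, dist_add_left, LinearIsometryEquiv.dist_map, EuclideanSpace.dist_eq]
    simp [Fin.sum_univ_two, Real.dist_eq, sq_abs]
  have hx : midpoint ℝ x y + (d / 2) • b 1 = x := by
    rw [hb, smul_smul, midpoint_eq_smul_add, invOf_eq_inv, show d / 2 * d⁻¹ = 1 / 2 by field_simp]
    module
  have hy : midpoint ℝ x y + (-(d / 2)) • b 1 = y := by
    rw [hb, smul_smul, midpoint_eq_smul_add, invOf_eq_inv, show -(d / 2) * d⁻¹ = -(1 / 2) by field_simp]
    module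
  set s := Set.Ioc (-(√3 / 2 * R)) (√3 / 2 * R)
  set f : ℝ → ℝ := fun a => √(R ^ 2 - a ^ 2) - R / 2
  have hfcont : Continuous f := by fun_prop
  have hf0 : ∀ a ∈ s, 0 ≤ f a := by
    intro a ha
    refine sub_nonneg.2 (Real.le_sqrt_of_sq_le ?_)
    have : a ^ 2 ≤ (√3 / 2 * R) ^ 2 := sq_le_sq' ha.1.le ha.2
    nlinarith
  have hsub : regionBetween (fun a => -f a) f s ⊆ T ⁻¹' (closedBall x R ∩ closedBall y R) := by
    rintro ⟨a, c⟩ ⟨ha, hc1, hc2⟩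
    simp only at ha hc1 hc2
    have hnn : 0 ≤ R ^ 2 - a ^ 2 := by
      have : a ^ 2 ≤ (√3 / 2 * R) ^ 2 := sq_le_sq' ha.1.le ha.2
      nlinarith
    have hkey : ∀ t : ℝ, |t| ≤ R / 2 → √(a ^ 2 + (c - t) ^ 2) ≤ R := by
      intro t ht
      obtain ⟨ht1, ht2⟩ := abs_le.1 ht
      rw [Real.sqrt_le_left hR.le]
      have : (c - t) ^ 2 ≤ √(R ^ 2 - a ^ 2) ^ 2 := by
        apply sq_le_sq' <;> simp only [f] at hc1 hc2 <;> linarith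
      rw [Real.sq_sqrt hnn] at this
      linarith
    have hd2 : |d / 2| ≤ R / 2 := by rw [abs_of_pos (by positivity)]; linarith
    refine ⟨?_, ?_⟩
    · have h := hdist (a, c) (d / 2)
      rw [hx] at h
      rw [mem_closedBall, h]
      exact hkey _ hd2
    · have h := hdist (a, c) (-(d / 2))
      rw [hy] at h
      rw [mem_closedBall, h]
      exact hkey _ (by rwa [abs_neg])
  have hvol : volume (regionBetween (fun a => -f a) f s) =
      ENNReal.ofReal ((2 * π / 3 - √3 / 2) * R ^ 2) := by
    rw [Measure.volume_eq_prod, volume_regionBetween_eq_integral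
      (f := fun a => -f a) (hfcont.neg.integrableOn_Ioc) (hfcont.integrableOn_Ioc) measurableSet_Ioc
      (fun a ha => by linarith [hf0 a ha])]
    congr 1
    have hle : -(√3 / 2 * R) ≤ √3 / 2 * R := by nlinarith [mul_pos h3pos hR]
    rw [← intervalIntegral.integral_of_le hle]
    have : ∀ a, (f - fun a => -f a) a = 2 * f a := fun a => by simp only [Pi.sub_apply]; ring
    simp only [this, f, intervalIntegral.integral_const_mul,
      integral_sqrt_sq_sub_sq_sub_half hR]
    ring
  have hle := measure_mono (μ := volume) hsub
  rw [hT.measure_preimage (measurableSet_closedBall.inter measurableSet_closedBall).nullMeasurableSet,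
    hvol] at hle
  exact (ENNReal.ofReal_le_iff_le_toReal (measure_inter_lt_top_of_left_ne_top
    measure_closedBall_lt_top.ne).ne).1 hle

theorem volume_real_closedBall_fin_two (x : EuclideanSpace ℝ (Fin 2)) {R : ℝ} (hR : 0 ≤ R) :
    volume.real (closedBall x R) = π * R ^ 2 := by
  rw [measureReal_def, EuclideanSpace.volume_closedBall_fin_two, ENNReal.toReal_mul, ENNReal.toReal_pow,
    ENNReal.toReal_ofReal hR]
  simp [mul_comm, Real.pi_nonneg]

theorem volume_real_closedBall_diff_le {x y : EuclideanSpace ℝ (Fin 2)} {R : ℝ}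
    (hne : x ≠ y) (hxy : ‖x - y‖ ≤ R) :
    volume.real (closedBall x R \ closedBall y R) ≤ (π / 3 + √3 / 2) * R ^ 2 := by
  have h := measureReal_inter_add_sdiff (μ := volume) (s := closedBall x R) (t := closedBall y R)
    measurableSet_closedBall measure_closedBall_lt_top.ne
  rw [volume_real_closedBall_fin_two x ((norm_nonneg _).trans hxy)] at h
  linarith [volume_real_inter_closedBall_ge hne hxy]

/-- In a finite set where every point is related to another one by an irreflexive symmetric relation, some
subset of at most half the points dominates all the others. -/
theorem Finset.exists_dominating_subset_two_mul_card_le {α : Type*} [DecidableEq α]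
    (X : Finset α) (adj : α → α → Prop) (hirrefl : ∀ x, ¬ adj x x)
    (hsymm : ∀ x y, adj x y → adj y x) (h : ∀ x ∈ X, ∃ y ∈ X, adj x y) :
    ∃ D ⊆ X, 2 * D.card ≤ X.card ∧ ∀ x ∈ X \ D, ∃ y ∈ D, adj x y := by
  classical
  let indep : Finset α → Prop := fun S => ∀ x ∈ S, ∀ y ∈ S, ¬ adj x y
  obtain ⟨S, hS⟩ := (X.powerset.filter indep).exists_maximal
    ⟨∅, by simp [indep]⟩
  have hmem := hS.prop
  rw [Finset.mem_filter, Finset.mem_powerset] at hmem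
  obtain ⟨hSX, hind⟩ := hmem
  have hdom : ∀ x ∈ X \ S, ∃ y ∈ S, adj x y := by
    intro x hx
    obtain ⟨hxX, hxS⟩ := Finset.mem_sdiff.1 hx
    by_contra! hno
    refine hxS (hS.le_of_ge (y := insert x S) ?_ (Finset.subset_insert x S)
      (Finset.mem_insert_self x S))
    rw [Finset.mem_filter, Finset.mem_powerset]
    refine ⟨Finset.insert_subset hxX hSX, ?_⟩
    intro a ha b hb hab
    rcases Finset.mem_insert.1 ha with rfl | haS <;>
      rcases Finset.mem_insert.1 hb with rfl | hbS
    · exact hirrefl _ hab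
    · exact hno b hbS hab
    · exact hno a haS (hsymm _ _ hab)
    · exact hind a haS b hbS hab
  have hcard := Finset.card_sdiff_add_card_eq_card hSX
  by_cases hle : 2 * S.card ≤ X.card
  · exact ⟨S, hSX, hle, hdom⟩
  · refine ⟨X \ S, Finset.sdiff_subset, by omega, fun x hx => ?_⟩
    rw [Finset.sdiff_sdiff_eq_self hSX] at hx
    obtain ⟨y, hy, hxy⟩ := h x (hSX hx)
    exact ⟨y, Finset.mem_sdiff.2 ⟨hy, fun hyS => hind x hx y hyS hxy⟩, hxy⟩

/-- If `X` is a finite set of at most `2k` points in the plane each of which has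
another point of `X` at distance `< 2r`, then the area of the union of the disks
of radius `2r` centered at `X` is at most `k·(16π/3 + 2√3)·r²`. -/
theorem area_union_badPoints_le
    (r : ℝ) (hr : 0 < r) (k : ℕ) (hk : 0 < k)
    (X : Finset (EuclideanSpace ℝ (Fin 2))) (hcard : X.card ≤ 2 * k)
    (hpair : ∀ x ∈ X, ∃ x' ∈ X, x' ≠ x ∧ ‖x - x'‖ < 2 * r) :
    (volume (⋃ x ∈ X, closedBall x (2 * r))).toReal ≤
      (k : ℝ) * (16 * π / 3 + 2 * Real.sqrt 3) * r ^ 2 := by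
  classical
  obtain ⟨D, hDX, hD, hdom⟩ := X.exists_dominating_subset_two_mul_card_le
    (fun x y => x ≠ y ∧ ‖x - y‖ < 2 * r)
    (fun x h => h.1 rfl) (fun x y h => ⟨h.1.symm, by rw [norm_sub_rev]; exact h.2⟩)
    (fun x hx => let ⟨y, hy, hne, h⟩ := hpair x hx; ⟨y, hy, hne.symm, h⟩)
  choose! g hgD hg using hdom
  have hsub : (⋃ x ∈ X, closedBall x (2 * r)) ⊆ (⋃ x ∈ D, closedBall x (2 * r)) ∪
      ⋃ x ∈ X \ D, (closedBall x (2 * r) \ closedBall (g x) (2 * r)) := by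
    intro p hp
    simp only [Set.mem_iUnion, Set.mem_union, exists_prop] at hp ⊢
    obtain ⟨x, hx, hpx⟩ := hp
    by_cases hxD : x ∈ D
    · exact Or.inl ⟨x, hxD, hpx⟩
    · have hxXD := Finset.mem_sdiff.2 ⟨hx, hxD⟩
      by_cases hpg : p ∈ closedBall (g x) (2 * r)
      · exact Or.inl ⟨g x, hgD x hxXD, hpg⟩
      · exact Or.inr ⟨x, hxXD, hpx, hpg⟩
  have hball : ∀ x : EuclideanSpace ℝ (Fin 2), volume (closedBall x (2 * r)) < ⊤ :=
    fun x => measure_closedBall_lt_top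
  have hfin1 : volume (⋃ x ∈ D, closedBall x (2 * r)) ≠ ⊤ :=
    (measure_biUnion_lt_top D.finite_toSet fun x _ => hball x).ne
  have hfin2 : volume (⋃ x ∈ X \ D, (closedBall x (2 * r) \ closedBall (g x) (2 * r))) ≠ ⊤ :=
    (measure_biUnion_lt_top (X \ D).finite_toSet fun x _ =>
      (measure_mono Set.sdiff_subset).trans_lt (hball x)).ne
  have h1 : volume.real (⋃ x ∈ D, closedBall x (2 * r)) ≤ D.card * (π * (2 * r) ^ 2) := by
    refine (measureReal_biUnion_finset_le _ _).trans ?_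
    rw [← nsmul_eq_mul]
    exact Finset.sum_le_card_nsmul _ _ _
      fun x _ => (volume_real_closedBall_fin_two x (by positivity)).le
  have h2 : volume.real (⋃ x ∈ X \ D, (closedBall x (2 * r) \ closedBall (g x) (2 * r))) ≤
      (X \ D).card * ((π / 3 + √3 / 2) * (2 * r) ^ 2) := by
    refine (measureReal_biUnion_finset_le _ _).trans ?_
    rw [← nsmul_eq_mul]
    exact Finset.sum_le_card_nsmul _ _ _
      fun x hx => volume_real_closedBall_diff_le (hg x hx).1 (hg x hx).2.le
  have h3 := (measureReal_mono (μ := volume) hsub (measure_union_ne_top hfin1 hfin2)).trans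
    (measureReal_union_le _ _)
  rw [measureReal_def] at h3
  have hsum : ((X \ D).card : ℝ) + D.card = X.card := by
    exact_mod_cast Finset.card_sdiff_add_card_eq_card hDX
  have hD' : 2 * (D.card : ℝ) ≤ X.card := by exact_mod_cast hD
  have hX' : (X.card : ℝ) ≤ 2 * k := by exact_mod_cast hcard
  have hlens : 0 ≤ 2 * π / 3 - √3 / 2 := by
    nlinarith [Real.pi_gt_three, Real.sq_sqrt (show (0 : ℝ) ≤ 3 by norm_num), Real.sqrt_nonneg 3]
  have hpi := Real.pi_pos
  have hfinal : D.card * π + (X \ D).card * (π / 3 + √3 / 2) ≤ k * (4 * π / 3 + √3 / 2) := by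
    rw [← eq_sub_iff_add_eq] at hsum
    rw [hsum]
    nlinarith [mul_nonneg (sub_nonneg.2 hD') hlens,
      mul_nonneg (sub_nonneg.2 hX') (show 0 ≤ 4 * π / 3 + √3 / 2 by positivity)]
  nlinarith [mul_le_mul_of_nonneg_right hfinal (show 0 ≤ (2 * r) ^ 2 by positivity)]
end
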